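/- arXiv:1707.03236 — 9 statements merged into one kernel-verified Lean document; each statement's English description precedes it below -/
import Mathlib

section
/- Let p, q ≥ 1 be natural numbers and let (a_{ij})_{1≤i≤p, 1≤j≤q} and (u_{ij})_{1≤i≤p, 1≤j≤q} be doubly indexed families of real numbers such that: (1) a_{ij} ≥ 0 for all i ∈ {1,...,p} and j ∈ {1,...,q}; (2) a_{i,j} − a_{i+1,j} − a_{i,j+1} + a_{i+1,j+1} ≥ 0 for all 1 ≤ i < p and 1 ≤ j < q, a_{i,q} − a_{i+1,q} ≥ 0 for all 1 ≤ i < p, and a_{p,j} − a_{p,j+1} ≥ 0 for all 1 ≤ j < q; (3) ∑_{k=1}^{i} ∑_{l=1}^{j} u_{kl} ≥ 0 for all i ∈ {1,...,p} and j ∈ {1,...,q}. Then ∑_{i=1}^{p} ∑_{j=1}^{q} a_{ij} u_{ij} ≥ 0. -/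
theorem abel_id_aux (b v : ℕ → ℝ) (n : ℕ) :
    ∑ j ∈ Finset.Icc 1 (n + 1), b j * v j =
      b (n + 1) * (∑ l ∈ Finset.Icc 1 (n + 1), v l) +
        ∑ j ∈ Finset.Icc 1 n, (b j - b (j + 1)) * ∑ l ∈ Finset.Icc 1 j, v l := by
  induction n with
  | zero => simp
  | succ n ih =>
    rw [Finset.sum_Icc_succ_top (by omega), ih, Finset.sum_Icc_succ_top (b := n + 1) (by omega),
      Finset.sum_Icc_succ_top (b := n) (by omega) (fun j => (b j - b (j + 1)) * _)]
    ring

theorem abel_ineq_aux (b v : ℕ → ℝ) (p : ℕ) (hp : 1 ≤ p) (hb : 0 ≤ b p)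
    (hd : ∀ i, 1 ≤ i → i < p → 0 ≤ b i - b (i + 1))
    (hv : ∀ i ∈ Finset.Icc 1 p, 0 ≤ ∑ k ∈ Finset.Icc 1 i, v k) :
    0 ≤ ∑ i ∈ Finset.Icc 1 p, b i * v i := by
  obtain ⟨n, rfl⟩ : ∃ n, p = n + 1 := ⟨p - 1, by omega⟩
  rw [abel_id_aux]
  refine add_nonneg (mul_nonneg hb (hv _ (by simp))) (Finset.sum_nonneg fun i hi => ?_)
  rw [Finset.mem_Icc] at hi
  exact mul_nonneg (hd i hi.1 (by omega)) (hv i (by rw [Finset.mem_Icc]; omega))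


/-- The Abel–Steffensen inequality for double sums of real numbers. -/
theorem abel_steffensen_double_sums (p q : ℕ) (hp : 1 ≤ p) (hq : 1 ≤ q)
    (a u : ℕ → ℕ → ℝ)
    (ha_nonneg : ∀ i ∈ Finset.Icc 1 p, ∀ j ∈ Finset.Icc 1 q, 0 ≤ a i j)
    (hΔ : ∀ i, 1 ≤ i → i < p → ∀ j, 1 ≤ j → j < q →
      0 ≤ a i j - a (i + 1) j - a i (j + 1) + a (i + 1) (j + 1))
    (hΔq : ∀ i, 1 ≤ i → i < p → 0 ≤ a i q - a (i + 1) q)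
    (hΔp : ∀ j, 1 ≤ j → j < q → 0 ≤ a p j - a p (j + 1))
    (hu : ∀ i ∈ Finset.Icc 1 p, ∀ j ∈ Finset.Icc 1 q,
      0 ≤ ∑ k ∈ Finset.Icc 1 i, ∑ l ∈ Finset.Icc 1 j, u k l) :
    0 ≤ ∑ i ∈ Finset.Icc 1 p, ∑ j ∈ Finset.Icc 1 q, a i j * u i j := by
  obtain ⟨n, rfl⟩ : ∃ n, q = n + 1 := ⟨q - 1, by omega⟩
  simp_rw [abel_id_aux]
  rw [Finset.sum_add_distrib, Finset.sum_comm]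
  refine add_nonneg ?_ (Finset.sum_nonneg fun j hj => ?_)
  · exact abel_ineq_aux (fun i => a i (n + 1)) _ p hp
      (ha_nonneg p (by simp [hp]) _ (by simp)) hΔq (fun i hi => hu i hi _ (by simp))
  · rw [Finset.mem_Icc] at hj
    refine abel_ineq_aux (fun i => a i j - a i (j + 1)) _ p hp
      (hΔp j hj.1 (by omega)) (fun i h1 h2 => ?_)
      (fun i hi => hu i hi j (by rw [Finset.mem_Icc]; omega))
    have := hΔ i h1 h2 j hj.1 (by omega)
    linarith
end

section
/- Let f be a twice continuously differentiable real-valued function on [a,b] × [c,d] (with continuous mixed partial derivative ∂²f/∂x∂y) and let w be a continuous real-valued function on [a,b] × [c,d]. Define W(x,y) = ∫_a^x ∫_c^y w(s,t) dt ds. Then ∫_a^b ∫_c^d f(x,y) w(x,y) dy dx = f(b,d) W(b,d) − ∫_a^b (∂f/∂x)(x,d) W(x,d) dx − ∫_c^d (∂f/∂y)(b,y) W(b,y) dy + ∫_a^b ∫_c^d W(x,y) (∂²f/∂x∂y)(x,y) dy dx. -/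
open intervalIntegral

theorem young_ibp (a b : ℝ) (hab : a < b) (u u' v : ℝ → ℝ)
    (hu : Continuous u) (hu' : Continuous u') (hv : Continuous v)
    (h : ∀ x ∈ Set.Ioo a b, HasDerivAt u (u' x) x) :
    ∫ x in a..b, u x * v x =
      u b * (∫ s in a..b, v s) - ∫ x in a..b, u' x * (∫ s in a..x, v s) := by
  have hV : ∀ x, HasDerivAt (fun x => ∫ s in a..x, v s) (v x) x := fun x =>
    intervalIntegral.integral_hasDerivAt_right (hv.intervalIntegrable _ _)
      hv.stronglyMeasurable.stronglyMeasurableAtFilter hv.continuousAt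
  have hVc : Continuous (fun x => ∫ s in a..x, v s) :=
    continuous_iff_continuousAt.2 fun x => (hV x).continuousAt
  have := intervalIntegral.integral_mul_deriv_eq_deriv_mul_of_hasDerivAt
    (a := a) (b := b) (u := u) (u' := u') (v := fun x => ∫ s in a..x, v s) (v' := v)
    hu.continuousOn hVc.continuousOn
    (by rw [min_eq_left hab.le, max_eq_right hab.le]; exact h) (fun x _ => hV x)
    (hu'.intervalIntegrable _ _) (hv.intervalIntegrable _ _)
  rw [this]
  simp

theorem young_swap (a b c d : ℝ) (F : ℝ → ℝ → ℝ) (hF : Continuous F.uncurry) :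
    ∫ x in a..b, ∫ y in c..d, F x y = ∫ y in c..d, ∫ x in a..b, F x y := by
  apply MeasureTheory.intervalIntegral_intervalIntegral_swap
  refine (hF.continuousOn.integrableOn_compact
    (isCompact_uIcc.prod isCompact_uIcc : IsCompact (Set.uIcc a b ×ˢ Set.uIcc c d))).mono_set ?_
  exact Set.prod_mono Set.uIoc_subset_uIcc Set.uIoc_subset_uIcc

theorem young_core
    (a b c d : ℝ) (hab : a < b) (hcd : c < d)
    (f fx fy fxy w : ℝ → ℝ → ℝ)
    (hfx : ∀ x ∈ Set.Ioo a b, ∀ y, HasDerivAt (fun x' => f x' y) (fx x y) x)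
    (hfy : ∀ x, ∀ y ∈ Set.Ioo c d, HasDerivAt (fun y' => f x y') (fy x y) y)
    (hfxy : ∀ x ∈ Set.Ioo a b, ∀ y, HasDerivAt (fun x' => fy x' y) (fxy x y) x)
    (cf : Continuous f.uncurry) (cfx : Continuous fx.uncurry) (cfy : Continuous fy.uncurry)
    (cfxy : Continuous fxy.uncurry) (cw : Continuous w.uncurry) :
    ∫ x in a..b, ∫ y in c..d, f x y * w x y =
      f b d * (∫ s in a..b, ∫ t in c..d, w s t)
      - (∫ x in a..b, fx x d * (∫ s in a..x, ∫ t in c..d, w s t))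
      - (∫ y in c..d, fy b y * (∫ s in a..b, ∫ t in c..y, w s t))
      + ∫ x in a..b, ∫ y in c..d, (∫ s in a..x, ∫ t in c..y, w s t) * fxy x y := by
  obtain ⟨V, hV⟩ : ∃ V : ℝ → ℝ → ℝ, ∀ x y, V x y = ∫ t in c..y, w x t := ⟨_, fun _ _ => rfl⟩
  obtain ⟨W, hW⟩ : ∃ W : ℝ → ℝ → ℝ, ∀ x y, W x y = ∫ s in a..x, V s y := ⟨_, fun _ _ => rfl⟩
  have cV : Continuous V.uncurry := by
    have := intervalIntegral.continuous_parametric_intervalIntegral_of_continuous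
      (μ := MeasureTheory.volume) (a₀ := c)
      (f := fun (p : ℝ × ℝ) t => w p.1 t) (s := fun p => p.2)
      (cw.comp (by fun_prop : Continuous fun q : (ℝ × ℝ) × ℝ => (q.1.1, q.2))) continuous_snd
    simpa only [Function.uncurry_def, hV] using this
  have cW : Continuous W.uncurry := by
    have := intervalIntegral.continuous_parametric_intervalIntegral_of_continuous
      (μ := MeasureTheory.volume) (a₀ := a)
      (f := fun (p : ℝ × ℝ) t => V t p.2) (s := fun p => p.1)
      (cV.comp (by fun_prop : Continuous fun q : (ℝ × ℝ) × ℝ => (q.2, q.1.2))) continuous_fst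
    simpa only [Function.uncurry_def, hW] using this
  simp only [← hV, ← hW]
  have sx : ∀ {g : ℝ → ℝ → ℝ}, Continuous g.uncurry → ∀ y, Continuous fun x => g x y :=
    fun hg y => hg.comp (by fun_prop : Continuous fun x : ℝ => (x, y))
  have sy : ∀ {g : ℝ → ℝ → ℝ}, Continuous g.uncurry → ∀ x, Continuous fun y => g x y :=
    fun hg x => hg.comp (by fun_prop : Continuous fun y : ℝ => (x, y))
  have e1 : ∀ x, ∫ y in c..d, f x y * w x y = f x d * V x d - ∫ y in c..d, fy x y * V x y := by
    intro x
    simp only [hV]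
    exact young_ibp c d hcd _ _ _ (sy cf x) (sy cfy x) (sy cw x) (hfy x)
  have e2 : ∫ x in a..b, f x d * V x d = f b d * W b d - ∫ x in a..b, fx x d * W x d := by
    simp only [hW]
    exact young_ibp a b hab _ _ _ (sx cf d) (sx cfx d) (sx cV d) (fun x hx => hfx x hx d)
  have e3 : ∀ y, ∫ x in a..b, fy x y * V x y =
      fy b y * W b y - ∫ x in a..b, W x y * fxy x y := by
    intro y
    simp only [hW, mul_comm _ (fxy _ y)]
    exact young_ibp a b hab _ _ _ (sx cfy y) (sx cfxy y) (sx cV y) (fun x hx => hfxy x hx y)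
  have cfyV : Continuous (fun x y => fy x y * V x y).uncurry := cfy.mul cV
  have cWf : Continuous (fun x y => W x y * fxy x y).uncurry := cW.mul cfxy
  have cI : Continuous fun x => ∫ y in c..d, fy x y * V x y :=
    intervalIntegral.continuous_parametric_intervalIntegral_of_continuous' cfyV c d
  have cJ : Continuous fun y => ∫ x in a..b, W x y * fxy x y :=
    intervalIntegral.continuous_parametric_intervalIntegral_of_continuous'
      (f := fun y x => W x y * fxy x y) (cWf.comp continuous_swap) a b
  have c1 : Continuous fun x => f x d * V x d := (sx cf d).mul (sx cV d)
  have c2 : Continuous fun y => fy b y * W b y := (sy cfy b).mul (sy cW b)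
  simp only [e1]
  rw [intervalIntegral.integral_sub (c1.intervalIntegrable _ _)
    (cI.intervalIntegrable _ _), e2, young_swap a b c d _ cfyV]
  simp only [e3]
  rw [intervalIntegral.integral_sub (c2.intervalIntegrable _ _)
    (cJ.intervalIntegrable _ _), young_swap a b c d _ cWf]
  ring

/-- Young's identity (Y1) for double integrals on a rectangle `[a,b] × [c,d]`.
Here `fx = ∂f/∂x`, `fy = ∂f/∂y`, `fxy = ∂²f/∂x∂y` and
`W x y = ∫_a^x ∫_c^y w(s,t) dt ds`. -/
theorem young_identity_Y1
    (a b c d : ℝ) (hab : a < b) (hcd : c < d)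
    (f fx fy fxy w : ℝ → ℝ → ℝ)
    (hfx : ∀ x ∈ Set.Icc a b, ∀ y ∈ Set.Icc c d, HasDerivAt (fun x' => f x' y) (fx x y) x)
    (hfy : ∀ x ∈ Set.Icc a b, ∀ y ∈ Set.Icc c d, HasDerivAt (fun y' => f x y') (fy x y) y)
    (hfxy : ∀ x ∈ Set.Icc a b, ∀ y ∈ Set.Icc c d, HasDerivAt (fun x' => fy x' y) (fxy x y) x)
    (hf_cont : ContinuousOn (fun p : ℝ × ℝ => f p.1 p.2) (Set.Icc a b ×ˢ Set.Icc c d))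
    (hfx_cont : ContinuousOn (fun p : ℝ × ℝ => fx p.1 p.2) (Set.Icc a b ×ˢ Set.Icc c d))
    (hfy_cont : ContinuousOn (fun p : ℝ × ℝ => fy p.1 p.2) (Set.Icc a b ×ˢ Set.Icc c d))
    (hfxy_cont : ContinuousOn (fun p : ℝ × ℝ => fxy p.1 p.2) (Set.Icc a b ×ˢ Set.Icc c d))
    (hw_cont : ContinuousOn (fun p : ℝ × ℝ => w p.1 p.2) (Set.Icc a b ×ˢ Set.Icc c d)) :
    ∫ x in a..b, ∫ y in c..d, f x y * w x y =
      f b d * (∫ s in a..b, ∫ t in c..d, w s t)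
      - (∫ x in a..b, fx x d * (∫ s in a..x, ∫ t in c..d, w s t))
      - (∫ y in c..d, fy b y * (∫ s in a..b, ∫ t in c..y, w s t))
      + ∫ x in a..b, ∫ y in c..d, (∫ s in a..x, ∫ t in c..y, w s t) * fxy x y := by
  have hP : ∀ x, max a (min b x) ∈ Set.Icc a b := fun x =>
    ⟨le_max_left _ _, max_le hab.le (min_le_left _ _)⟩
  have hQ : ∀ y, max c (min d y) ∈ Set.Icc c d := fun x =>
    ⟨le_max_left _ _, max_le hcd.le (min_le_left _ _)⟩
  have eP : ∀ x ∈ Set.Icc a b, max a (min b x) = x := fun x hx => by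
    rw [min_eq_right hx.2, max_eq_right hx.1]
  have eQ : ∀ x ∈ Set.Icc c d, max c (min d x) = x := fun x hx => by
    rw [min_eq_right hx.2, max_eq_right hx.1]
  have nP : ∀ x ∈ Set.Ioo a b, (fun x => max a (min b x)) =ᶠ[nhds x] id := fun x hx => by
    filter_upwards [Icc_mem_nhds hx.1 hx.2] with z hz using eP z hz
  have nQ : ∀ x ∈ Set.Ioo c d, (fun x => max c (min d x)) =ᶠ[nhds x] id := fun x hx => by
    filter_upwards [Icc_mem_nhds hx.1 hx.2] with z hz using eQ z hz
  obtain ⟨E, hE⟩ : ∃ E : (ℝ → ℝ → ℝ) → ℝ → ℝ → ℝ,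
    ∀ g x y, E g x y = g (max a (min b x)) (max c (min d y)) := ⟨_, fun _ _ _ => rfl⟩
  have cE : ∀ g : ℝ → ℝ → ℝ,
      ContinuousOn (fun p : ℝ × ℝ => g p.1 p.2) (Set.Icc a b ×ˢ Set.Icc c d) →
      Continuous (E g).uncurry := by
    intro g hg
    have := hg.comp_continuous
      (by fun_prop : Continuous fun p : ℝ × ℝ => (max a (min b p.1), max c (min d p.2)))
      (fun p => ⟨hP _, hQ _⟩)
    simp only [Function.uncurry_def, hE]
    exact this
  have vE : ∀ g, ∀ x ∈ Set.Icc a b, ∀ y ∈ Set.Icc c d, E g x y = g x y := by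
    intro g x hx y hy
    rw [hE, eP x hx, eQ y hy]
  have key := young_core a b c d hab hcd (E f) (E fx) (E fy) (E fxy) (E w)
    (by
      intro x hx y
      simp only [hE, eP x (Set.Ioo_subset_Icc_self hx)]
      refine (hfx x (Set.Ioo_subset_Icc_self hx) _ (hQ y)).congr_of_eventuallyEq ?_
      filter_upwards [nP x hx] with z hz
      simp only [id] at hz
      rw [hz])
    (by
      intro x y hy
      simp only [hE, eQ y (Set.Ioo_subset_Icc_self hy)]
      refine (hfy _ (hP x) y (Set.Ioo_subset_Icc_self hy)).congr_of_eventuallyEq ?_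
      filter_upwards [nQ y hy] with z hz
      simp only [id] at hz
      rw [hz])
    (by
      intro x hx y
      simp only [hE, eP x (Set.Ioo_subset_Icc_self hx)]
      refine (hfxy x (Set.Ioo_subset_Icc_self hx) _ (hQ y)).congr_of_eventuallyEq ?_
      filter_upwards [nP x hx] with z hz
      simp only [id] at hz
      rw [hz])
    (cE f hf_cont) (cE fx hfx_cont) (cE fy hfy_cont) (cE fxy hfxy_cont) (cE w hw_cont)
  have hb : b ∈ Set.Icc a b := Set.right_mem_Icc.2 hab.le
  have hd : d ∈ Set.Icc c d := Set.right_mem_Icc.2 hcd.le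
  have uI : ∀ {p q x : ℝ}, p ≤ q → x ∈ Set.uIcc p q → x ∈ Set.Icc p q := fun h hx => by
    rwa [Set.uIcc_of_le h] at hx
  have hWW : ∀ x ∈ Set.Icc a b, ∀ y ∈ Set.Icc c d,
      ∫ s in a..x, ∫ t in c..y, E w s t = ∫ s in a..x, ∫ t in c..y, w s t := by
    intro x hx y hy
    refine intervalIntegral.integral_congr fun s hs => ?_
    refine intervalIntegral.integral_congr fun t ht => ?_
    have hs' := uI hx.1 hs
    have ht' := uI hy.1 ht
    exact vE w s ⟨hs'.1, hs'.2.trans hx.2⟩ t ⟨ht'.1, ht'.2.trans hy.2⟩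
  have k1 : ∫ x in a..b, ∫ y in c..d, E f x y * E w x y =
      ∫ x in a..b, ∫ y in c..d, f x y * w x y := by
    refine intervalIntegral.integral_congr fun s hs => ?_
    refine intervalIntegral.integral_congr fun t ht => ?_
    simp only [vE _ s (uI hab.le hs) t (uI hcd.le ht)]
  have k2 : ∫ x in a..b, E fx x d * (∫ s in a..x, ∫ t in c..d, E w s t) =
      ∫ x in a..b, fx x d * (∫ s in a..x, ∫ t in c..d, w s t) := by
    refine intervalIntegral.integral_congr fun s hs => ?_
    simp only [vE _ s (uI hab.le hs) d hd, hWW s (uI hab.le hs) d hd]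
  have k3 : ∫ y in c..d, E fy b y * (∫ s in a..b, ∫ t in c..y, E w s t) =
      ∫ y in c..d, fy b y * (∫ s in a..b, ∫ t in c..y, w s t) := by
    refine intervalIntegral.integral_congr fun t ht => ?_
    simp only [vE _ b hb t (uI hcd.le ht), hWW b hb t (uI hcd.le ht)]
  have k4 : ∫ x in a..b, ∫ y in c..d, (∫ s in a..x, ∫ t in c..y, E w s t) * E fxy x y =
      ∫ x in a..b, ∫ y in c..d, (∫ s in a..x, ∫ t in c..y, w s t) * fxy x y := by
    refine intervalIntegral.integral_congr fun s hs => ?_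
    refine intervalIntegral.integral_congr fun t ht => ?_
    simp only [vE _ s (uI hab.le hs) t (uI hcd.le ht), hWW s (uI hab.le hs) t (uI hcd.le ht)]
  rw [k1, k2, k3, k4, hWW b hb d hd, vE f b hb d hd] at key
  exact key
end

section
/- Let f and w be real-valued functions on [a,b] × [c,d] such that: (i) f is continuously differentiable and 2d-monotone decreasing; (ii) w is integrable and W(x,y) = ∫_a^x ∫_c^y w(s,t) dt ds ≥ 0 for all (x,y) ∈ [a,b] × [c,d]. Then ∫_a^b ∫_c^d f(x,y) w(x,y) dy dx ≥ f(b,d) W(b,d). -/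
open intervalIntegral MeasureTheory

theorem steff_level (c d : ℝ) (hcd : c ≤ d) (h : ℝ → ℝ) (A : Set ℝ)
    (hA : ∀ x y, x ≤ y → y ∈ A → x ∈ A) (hAm : MeasurableSet A)
    (hH : ∀ y ∈ Set.Icc c d, 0 ≤ ∫ t in c..y, h t) :
    0 ≤ ∫ t in Set.Ioc c d, A.indicator h t := by
  rw [MeasureTheory.setIntegral_indicator hAm]
  by_cases hne : (Set.Ioc c d ∩ A).Nonempty
  · have hbdd : BddAbove (Set.Ioc c d ∩ A) := ⟨d, fun x hx => hx.1.2⟩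
    set t := sSup (Set.Ioc c d ∩ A) with ht
    have h1 : Set.Ioc c d ∩ A ⊆ Set.Ioc c t := fun x hx => ⟨hx.1.1, le_csSup hbdd hx⟩
    have htd : t ≤ d := csSup_le hne fun x hx => hx.1.2
    have h2 : Set.Ioo c t ⊆ Set.Ioc c d ∩ A := by
      intro x hx
      obtain ⟨y, hy, hxy⟩ := exists_lt_of_lt_csSup hne hx.2
      exact ⟨⟨hx.1, hxy.le.trans hy.1.2⟩, hA x y hxy.le hy.2⟩
    have hct : c ≤ t := by
      obtain ⟨x, hx⟩ := hne
      exact hx.1.1.le.trans (le_csSup hbdd hx)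
    have h3 : (Set.Ioc c d ∩ A : Set ℝ) =ᵐ[volume] Set.Ioc c t := by
      apply Filter.EventuallyLE.antisymm
      · exact HasSubset.Subset.eventuallyLE h1
      · exact (Ioo_ae_eq_Ioc (μ := volume) (a := c) (b := t)).symm.le.trans
          (HasSubset.Subset.eventuallyLE h2)
    rw [setIntegral_congr_set h3, ← intervalIntegral.integral_of_le hct]
    exact hH t ⟨hct, htd⟩
  · rw [Set.not_nonempty_iff_eq_empty.1 hne]; simp

theorem steff_one (c d : ℝ) (hcd : c ≤ d) (g h : ℝ → ℝ)
    (hg : AntitoneOn g (Set.Icc c d)) (hh : IntegrableOn h (Set.Ioc c d))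
    (hH : ∀ y ∈ Set.Icc c d, 0 ≤ ∫ t in c..y, h t) :
    g d * (∫ t in Set.Ioc c d, h t) ≤ ∫ t in Set.Ioc c d, g t * h t := by
  have hc : c ∈ Set.Icc c d := ⟨le_rfl, hcd⟩
  have hd : d ∈ Set.Icc c d := ⟨hcd, le_rfl⟩
  obtain ⟨k, hk, hgk⟩ := hg.exists_antitone_extension
    ⟨g d, by rintro _ ⟨x, hx, rfl⟩; exact hg hx hd hx.2⟩
    ⟨g c, by rintro _ ⟨x, hx, rfl⟩; exact hg hc hx hx.1⟩
  have e1 : ∫ t in Set.Ioc c d, g t * h t = ∫ t in Set.Ioc c d, k t * h t :=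
    setIntegral_congr_fun measurableSet_Ioc fun t ht => by
      simp only [hgk (Set.Ioc_subset_Icc_self ht)]
  rw [e1, hgk hd]
  have hkm : Measurable k := hk.measurable
  set M := k c - k d with hM
  have hM0 : 0 ≤ M := sub_nonneg.2 (hk hcd)
  let S : Set (ℝ × ℝ) := {p | p.2 + k d < k p.1}
  have hS : MeasurableSet S := by
    apply measurableSet_lt <;> fun_prop
  have hint : Integrable (Function.uncurry fun y l => S.indicator (fun p => h p.1) (y, l))
      ((volume.restrict (Set.Ioc c d)).prod (volume.restrict (Set.Ioc 0 M))) :=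
    (Integrable.comp_fst hh _).indicator hS
  have hsw := integral_integral_swap hint
  have hrhs : 0 ≤ ∫ l in Set.Ioc 0 M, ∫ y in Set.Ioc c d, S.indicator (fun p => h p.1) (y, l) := by
    refine integral_nonneg fun l => ?_
    refine steff_level c d hcd h {y | l + k d < k y} ?_ ?_ hH
    · intro x y hxy hy
      exact lt_of_lt_of_le hy (hk hxy)
    · exact measurableSet_lt (by fun_prop) hkm
  rw [← hsw] at hrhs
  have hlhs : ∀ y ∈ Set.Ioc c d, ∫ l in Set.Ioc 0 M, S.indicator (fun p => h p.1) (y, l)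
      = k y * h y - k d * h y := by
    intro y hy
    have : (fun l => S.indicator (fun p => h p.1) (y, l))
        = (Set.Iio (k y - k d)).indicator (fun _ => h y) := by
      ext l
      simp only [Set.indicator, S, Set.mem_setOf_eq, Set.mem_Iio, lt_sub_iff_add_lt]
    rw [this, MeasureTheory.setIntegral_indicator measurableSet_Iio]
    have h0 : 0 ≤ k y - k d := sub_nonneg.2 (hk hy.2)
    have h1 : k y - k d ≤ M := sub_le_sub_right (hk hy.1.le) _
    have h3 : (Set.Ioc 0 M ∩ Set.Iio (k y - k d) : Set ℝ) = Set.Ioo 0 (k y - k d) := by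
      ext l; simp only [Set.mem_inter_iff, Set.mem_Ioc, Set.mem_Iio, Set.mem_Ioo]
      constructor
      · rintro ⟨⟨_, _⟩, _⟩; constructor <;> assumption
      · rintro ⟨_, _⟩; refine ⟨⟨?_, ?_⟩, ?_⟩ <;> linarith
    rw [h3]
    simp [h0]; ring
  rw [setIntegral_congr_fun measurableSet_Ioc hlhs] at hrhs
  have hkh : Integrable (fun y => k y * h y) (volume.restrict (Set.Ioc c d)) := by
    refine Integrable.bdd_mul (c := max |k c| |k d|) hh hkm.aestronglyMeasurable ?_
    filter_upwards [ae_restrict_mem measurableSet_Ioc] with y hy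
    rw [Real.norm_eq_abs, max_comm]
    exact abs_le_max_abs_abs (hk hy.2) (hk hy.1.le)
  rw [integral_sub hkh (hh.const_mul _), MeasureTheory.integral_const_mul] at hrhs
  linarith

theorem steff_core (a b c d : ℝ) (hab : a ≤ b) (hcd : c ≤ d)
    (f w φ : ℝ → ℝ → ℝ) (g : ℝ → ℝ) (hφ : Continuous (Function.uncurry φ))
    (hg : Continuous g)
    (hrep : ∀ x ∈ Set.Icc a b, ∀ y ∈ Set.Icc c d, f x y = g y + ∫ s in x..b, φ s y)
    (hga : AntitoneOn g (Set.Icc c d))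
    (hφa : ∀ s ∈ Set.Icc a b, AntitoneOn (φ s) (Set.Icc c d))
    (hφ0 : ∀ s ∈ Set.Icc a b, 0 ≤ φ s d)
    (hw : IntegrableOn (fun p : ℝ × ℝ => w p.1 p.2) (Set.Icc a b ×ˢ Set.Icc c d))
    (hW : ∀ x ∈ Set.Icc a b, ∀ y ∈ Set.Icc c d, 0 ≤ ∫ s in a..x, ∫ t in c..y, w s t) :
    g d * (∫ s in a..b, ∫ t in c..d, w s t) ≤
      ∫ x in a..b, ∫ y in c..d, f x y * w x y := by
  set μ : Measure ℝ := volume.restrict (Set.Ioc a b) with hμ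
  set ν : Measure ℝ := volume.restrict (Set.Ioc c d) with hν
  have hwi : Integrable (fun p : ℝ × ℝ => w p.1 p.2) (μ.prod ν) := by
    rw [hμ, hν, Measure.prod_restrict]
    exact hw.mono_set (Set.prod_mono Set.Ioc_subset_Icc_self Set.Ioc_subset_Icc_self)
  have hwx : ∀ x ∈ Set.Icc a b, ∀ y ∈ Set.Icc c d, Integrable (fun p : ℝ × ℝ => w p.1 p.2)
      ((volume.restrict (Set.Ioc a x)).prod (volume.restrict (Set.Ioc c y))) := by
    intro x hx y hy
    rw [Measure.prod_restrict]
    exact hw.mono_set (Set.prod_mono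
      (Set.Ioc_subset_Icc_self.trans (Set.Icc_subset_Icc_right hx.2))
      (Set.Ioc_subset_Icc_self.trans (Set.Icc_subset_Icc_right hy.2)))
  have ha : a ∈ Set.Icc a b := ⟨le_rfl, hab⟩
  have hb : b ∈ Set.Icc a b := ⟨hab, le_rfl⟩
  have hd : d ∈ Set.Icc c d := ⟨hcd, le_rfl⟩
  -- swapped integrals
  have hV : ∀ x ∈ Set.Icc a b, ∀ y ∈ Set.Icc c d,
      ∫ t in c..y, ∫ s in Set.Ioc a x, w s t = ∫ s in a..x, ∫ t in c..y, w s t := by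
    intro x hx y hy
    rw [intervalIntegral.integral_of_le hx.1, intervalIntegral.integral_of_le hy.1]
    simp only [intervalIntegral.integral_of_le hy.1]
    exact (integral_integral_swap (hwx x hx y hy)).symm
  have hone : ∀ x ∈ Set.Icc a b, ∀ k : ℝ → ℝ, AntitoneOn k (Set.Icc c d) →
      k d * (∫ s in a..x, ∫ t in c..d, w s t) ≤
        ∫ t in Set.Ioc c d, k t * ∫ s in Set.Ioc a x, w s t := by
    intro x hx k hk
    have := steff_one c d hcd k (fun t => ∫ s in Set.Ioc a x, w s t) hk
      (Integrable.integral_prod_right (hwx x hx d hd))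
      (fun y hy => by rw [hV x hx y hy]; exact hW x hx y hy)
    rwa [← intervalIntegral.integral_of_le hcd, hV x hx d hd] at this
  -- triple function
  let T : ℝ × ℝ → ℝ → ℝ := fun p s => (if p.1 < s then φ s p.2 else 0) * w p.1 p.2
  obtain ⟨C, hC⟩ : ∃ C, ∀ p ∈ Set.Icc a b ×ˢ Set.Icc c d, ‖Function.uncurry φ p‖ ≤ C :=
    (isCompact_Icc.prod isCompact_Icc).exists_bound_of_continuousOn hφ.continuousOn
  have hmemp : ∀ᵐ p ∂(μ.prod ν), p ∈ Set.Ioc a b ×ˢ Set.Ioc c d := by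
    rw [hμ, hν, Measure.prod_restrict]
    exact ae_restrict_mem (measurableSet_Ioc.prod measurableSet_Ioc)
  have hT : Integrable (Function.uncurry T) ((μ.prod ν).prod μ) := by
    refine Integrable.bdd_mul (c := max C 0) (Integrable.comp_fst hwi μ) ?_ ?_
    · apply Measurable.aestronglyMeasurable
      refine Measurable.ite (measurableSet_lt (by fun_prop) (by fun_prop)) ?_ measurable_const
      exact hφ.measurable.comp (by fun_prop : Measurable fun q : (ℝ × ℝ) × ℝ => (q.2, q.1.2))
    · have : ∀ᵐ q ∂((μ.prod ν).prod μ), q ∈ (Set.Ioc a b ×ˢ Set.Ioc c d) ×ˢ Set.Ioc a b := by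
        rw [hμ, hν, Measure.prod_restrict, Measure.prod_restrict]
        exact ae_restrict_mem ((measurableSet_Ioc.prod measurableSet_Ioc).prod measurableSet_Ioc)
      filter_upwards [this] with q hq
      split_ifs
      · exact (hC (q.2, q.1.2) ⟨Set.Ioc_subset_Icc_self hq.2,
          Set.Ioc_subset_Icc_self hq.1.2⟩).trans (le_max_left _ _)
      · simp
  have hgw : Integrable (fun p : ℝ × ℝ => g p.2 * w p.1 p.2) (μ.prod ν) := by
    obtain ⟨D, hD⟩ := (isCompact_Icc (a := c) (b := d)).exists_bound_of_continuousOn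
      hg.continuousOn
    refine Integrable.bdd_mul (c := D) hwi (by fun_prop) ?_
    filter_upwards [hmemp] with p hp
    exact hD _ (Set.Ioc_subset_Icc_self hp.2)
  have hTi : Integrable (fun p => ∫ s, T p s ∂μ) (μ.prod ν) := hT.integral_prod_left
  have hfw : ∀ p ∈ Set.Ioc a b ×ˢ Set.Ioc c d,
      f p.1 p.2 * w p.1 p.2 = g p.2 * w p.1 p.2 + ∫ s, T p s ∂μ := by
    rintro ⟨x, y⟩ ⟨hx, hy⟩
    simp only at hx hy ⊢
    simp only [T]
    rw [MeasureTheory.integral_mul_const, hrep x (Set.Ioc_subset_Icc_self hx) y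
      (Set.Ioc_subset_Icc_self hy), add_mul]
    congr 2
    have : (fun s => if x < s then φ s y else 0) = (Set.Ioi x).indicator (fun s => φ s y) := by
      ext s; simp [Set.indicator]
    rw [this, hμ, MeasureTheory.setIntegral_indicator measurableSet_Ioi,
      intervalIntegral.integral_of_le hx.2]
    congr 2
    ext s; simp only [Set.mem_inter_iff, Set.mem_Ioc, Set.mem_Ioi]
    constructor
    · rintro ⟨h1, h2⟩; exact ⟨⟨hx.1.trans h1, h2⟩, h1⟩
    · rintro ⟨⟨_, h2⟩, h1⟩; exact ⟨h1, h2⟩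
  have hfw' : (fun p : ℝ × ℝ => g p.2 * w p.1 p.2 + ∫ s, T p s ∂μ) =ᵐ[μ.prod ν]
      (fun p : ℝ × ℝ => f p.1 p.2 * w p.1 p.2) := by
    filter_upwards [hmemp] with p hp using (hfw p hp).symm
  have hmain : ∫ x in a..b, ∫ y in c..d, f x y * w x y
      = (∫ p, g p.2 * w p.1 p.2 ∂(μ.prod ν)) + ∫ s, ∫ p, T p s ∂(μ.prod ν) ∂μ := by
    rw [intervalIntegral.integral_of_le hab]
    simp only [intervalIntegral.integral_of_le hcd]
    rw [← integral_integral_swap hT, ← integral_add hgw hTi, integral_congr_ae hfw',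
      integral_prod _ ((hgw.add hTi).congr hfw')]
  rw [hmain]
  have h1 : g d * (∫ s in a..b, ∫ t in c..d, w s t) ≤ ∫ p, g p.2 * w p.1 p.2 ∂(μ.prod ν) := by
    rw [integral_prod_symm _ hgw]
    simp only [MeasureTheory.integral_const_mul]
    exact hone b hb g hga
  have h2 : 0 ≤ ∫ s, ∫ p, T p s ∂(μ.prod ν) ∂μ := by
    apply MeasureTheory.integral_nonneg_of_ae
    filter_upwards [hT.prod_left_ae, ae_restrict_mem (μ := volume) measurableSet_Ioc] with s hs hsm
    have hsm' := Set.Ioc_subset_Icc_self hsm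
    rw [Pi.zero_apply]
    change Integrable (fun p => T p s) _ at hs
    rw [integral_prod_symm _ hs]
    have h3 : ∀ y, ∫ x, T (x, y) s ∂μ = φ s y * ∫ x in Set.Ioc a s, w x y := by
      intro y
      have : (fun x => T (x, y) s) = (Set.Iio s).indicator (fun x => φ s y * w x y) := by
        ext x; simp only [T, Set.indicator, Set.mem_Iio]; split_ifs <;> simp
      rw [this, hμ, MeasureTheory.setIntegral_indicator measurableSet_Iio,
        MeasureTheory.integral_const_mul]
      congr 1
      apply setIntegral_congr_set
      have : (Set.Ioc a b ∩ Set.Iio s : Set ℝ) = Set.Ioo a s := by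
        ext x; simp only [Set.mem_inter_iff, Set.mem_Ioc, Set.mem_Iio, Set.mem_Ioo]
        constructor
        · rintro ⟨⟨h1, _⟩, h2⟩; exact ⟨h1, h2⟩
        · rintro ⟨h1, h2⟩; exact ⟨⟨h1, h2.le.trans hsm.2⟩, h2⟩
      rw [this]
      exact Ioo_ae_eq_Ioc
    simp only [h3]
    exact (mul_nonneg (hφ0 s hsm') (hW s hsm' d hd)).trans (hone s hsm' (φ s) (hφa s hsm'))
  linarith

theorem abel_steffensen_integral
    (a b c d : ℝ) (hab : a ≤ b) (hcd : c ≤ d)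
    (f w : ℝ → ℝ → ℝ)
    (hf : ContDiffOn ℝ 1 (fun p : ℝ × ℝ => f p.1 p.2) (Set.Icc a b ×ˢ Set.Icc c d))
    (hf2d : ∀ a' ∈ Set.Icc a b, ∀ b' ∈ Set.Icc a b, ∀ c' ∈ Set.Icc c d, ∀ d' ∈ Set.Icc c d,
      a' ≤ b' → c' ≤ d' → 0 ≤ f a' c' - f a' d' - f b' c' + f b' d')
    (hf_dec_x : ∀ y ∈ Set.Icc c d, AntitoneOn (fun x => f x y) (Set.Icc a b))
    (hf_dec_y : ∀ x ∈ Set.Icc a b, AntitoneOn (fun y => f x y) (Set.Icc c d))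
    (hw : IntegrableOn (fun p : ℝ × ℝ => w p.1 p.2) (Set.Icc a b ×ˢ Set.Icc c d))
    (hW : ∀ x ∈ Set.Icc a b, ∀ y ∈ Set.Icc c d, 0 ≤ ∫ s in a..x, ∫ t in c..y, w s t) :
    f b d * (∫ s in a..b, ∫ t in c..d, w s t) ≤
      ∫ x in a..b, ∫ y in c..d, f x y * w x y := by
  rcases hab.eq_or_lt with rfl | hab'
  · simp
  rcases hcd.eq_or_lt with rfl | hcd'
  · simp
  set R := Set.Icc a b ×ˢ Set.Icc c d with hR
  have hU : UniqueDiffOn ℝ R := (uniqueDiffOn_Icc hab').prod (uniqueDiffOn_Icc hcd')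
  have hb : b ∈ Set.Icc a b := ⟨hab, le_rfl⟩
  have hd : d ∈ Set.Icc c d := ⟨hcd, le_rfl⟩
  let ψ : ℝ × ℝ → ℝ := fun p => fderivWithin ℝ (fun p : ℝ × ℝ => f p.1 p.2) R p (1, 0)
  have hψ : ContinuousOn ψ R :=
    (hf.continuousOn_fderivWithin hU le_rfl).clm_apply continuousOn_const
  have hder : ∀ s ∈ Set.Icc a b, ∀ y ∈ Set.Icc c d,
      HasDerivWithinAt (fun x => f x y) (ψ (s, y)) (Set.Icc a b) s := by
    intro s hs y hy
    have h1 := (hf.differentiableOn one_ne_zero (s, y) ⟨hs, hy⟩).hasFDerivWithinAt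
    have h2 : HasDerivWithinAt (fun x : ℝ => (x, y)) ((1 : ℝ), (0 : ℝ)) (Set.Icc a b) s :=
      (hasDerivWithinAt_id s _).prodMk (hasDerivWithinAt_const s _ y)
    exact HasFDerivWithinAt.comp_hasDerivWithinAt (f := fun x : ℝ => (x, y)) (t := R) s h1 h2
      (fun x hx => ⟨hx, hy⟩)
  let pa : ℝ → ℝ := fun x => Set.projIcc a b hab x
  let pc : ℝ → ℝ := fun x => Set.projIcc c d hcd x
  have hpa : Continuous pa := continuous_subtype_val.comp continuous_projIcc
  have hpc : Continuous pc := continuous_subtype_val.comp continuous_projIcc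
  have hpam : ∀ x, pa x ∈ Set.Icc a b := fun x => (Set.projIcc a b hab x).2
  have hpcm : ∀ x, pc x ∈ Set.Icc c d := fun x => (Set.projIcc c d hcd x).2
  have hpae : ∀ x ∈ Set.Icc a b, pa x = x := fun x hx => by simp [pa, Set.projIcc_of_mem hab hx]
  have hpce : ∀ x ∈ Set.Icc c d, pc x = x := fun x hx => by simp [pc, Set.projIcc_of_mem hcd hx]
  have hφ : Continuous (Function.uncurry fun s y => -ψ (pa s, pc y)) := by
    apply Continuous.neg
    exact hψ.comp_continuous (f := fun p : ℝ × ℝ => (pa p.1, pc p.2)) (by fun_prop)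
      fun p => ⟨hpam _, hpcm _⟩
  have hg : Continuous fun y => f b (pc y) :=
    hf.continuousOn.comp_continuous (f := fun y => (b, pc y)) (by fun_prop)
      fun y => ⟨hb, hpcm _⟩
  have key := steff_core a b c d hab hcd f w (fun s y => -ψ (pa s, pc y)) (fun y => f b (pc y))
    hφ hg ?_ ?_ ?_ ?_ hw hW
  · simpa only [hpce d hd] using key
  · intro x hx y hy
    have hsub : Set.Icc x b ⊆ Set.Icc a b := Set.Icc_subset_Icc_left hx.1
    have := integral_eq_sub_of_hasDerivAt_of_le (f := fun x => f x y)
      (f' := fun s => ψ (pa s, pc y)) hx.2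
      (fun s hs => ((hder s (hsub hs) y hy).continuousWithinAt).mono hsub)
      (fun s hs => by
        have hs' := hsub (Set.Ioo_subset_Icc_self hs)
        simp only [hpae s hs', hpce y hy]
        exact (hder s hs' y hy).hasDerivAt (Icc_mem_nhds (hx.1.trans_lt hs.1) hs.2))
      (by
        apply Continuous.intervalIntegrable
        exact hψ.comp_continuous (f := fun s : ℝ => (pa s, pc y)) (by fun_prop)
          fun p => ⟨hpam _, hpcm _⟩)
    rw [intervalIntegral.integral_neg, this, hpce y hy]
    ring
  · intro y hy z hz hyz
    simp only [hpce y hy, hpce z hz]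
    exact hf_dec_y b hb hy hz hyz
  · intro s hs y hy z hz hyz
    simp only [hpce y hy, hpce z hz, hpae s hs]
    have h1 := (hder s hs y hy).sub (hder s hs z hz)
    have h2 : AntitoneOn ((fun x => f x y) - fun x => f x z) (Set.Icc a b) := by
      intro u hu v hv huv
      have := hf2d u hu v hv y hy z hz huv hyz
      simp only [Pi.sub_apply]
      linarith
    have h3 := h2.derivWithin_nonpos (x := s)
    rw [h1.derivWithin (uniqueDiffOn_Icc hab' s hs)] at h3
    linarith
  · intro s hs
    simp only [hpce d hd, hpae s hs]
    have h3 := (hf_dec_x d hd).derivWithin_nonpos (x := s)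
    rw [(hder s hs d hd).derivWithin (uniqueDiffOn_Icc hab' s hs)] at h3
    linarith
end

section
/- Let f and w be real-valued functions on [a,b] × [c,d] such that: (i) f is nonnegative, continuous, 2d-monotone decreasing, and admits a representation f(x,y) = f(a,c) + ∫_a^x g₁(s) ds + ∫_c^y g₂(t) dt + ∫_a^x ∫_c^y g(s,t) dt ds for all (x,y) ∈ [a,b] × [c,d], for suitable integrable functions g₁ ∈ L¹([a,b]), g₂ ∈ L¹([c,d]) and g ∈ L¹([a,b] × [c,d]); (ii) w is integrable and W(x,y) = ∫_a^x ∫_c^y w(s,t) dt ds ≥ 0 for all (x,y) ∈ [a,b] × [c,d]. Then ∫_a^b ∫_c^d f(x,y) w(x,y) dy dx ≥ f(b,d) W(b,d). -/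
open intervalIntegral MeasureTheory

lemma ASaux_mono (E N : ℝ → ℝ) (a b : ℝ) (hab : a ≤ b)
    (H : ∀ ε > 0, ∃ δ > 0, ∀ x ∈ Set.Icc a b, ∀ x' ∈ Set.Icc a b, x ≤ x' → x' < x + δ →
      -ε * (N x' - N x) ≤ E x' - E x) : E a ≤ E b := by
  have key : ∀ ε > 0, -ε * (N b - N a) ≤ E b - E a := by
    intro ε hε
    obtain ⟨δ, hδ, h⟩ := H ε hε
    have ind : ∀ k : ℕ, ∀ x ∈ Set.Icc a b, x ≤ a + k * (δ / 2) →
        -ε * (N x - N a) ≤ E x - E a := by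
      intro k
      induction k with
      | zero =>
        intro x hx hk
        have : x = a := le_antisymm (by simpa using hk) hx.1
        subst this; simp
      | succ k ih =>
        intro x hx hk
        push_cast at hk
        have m1 : max a (x - δ / 2) ∈ Set.Icc a b :=
          ⟨le_max_left _ _, max_le hab (by linarith [hx.2])⟩
        have h1 := ih (max a (x - δ / 2)) m1 (max_le (by
          have : (0:ℝ) ≤ k * (δ / 2) := by positivity
          linarith) (by linarith))
        have h2 := h _ m1 x hx (max_le hx.1 (by linarith))
          (by linarith [le_max_right a (x - δ / 2)])
        linarith
    obtain ⟨k, hk⟩ := exists_nat_gt ((b - a) / (δ / 2))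
    rw [div_lt_iff₀ (by linarith)] at hk
    exact ind k b ⟨hab, le_rfl⟩ (by linarith)
  by_contra hlt
  push Not at hlt
  have hp : 0 < |N b - N a| + 1 := by positivity
  have := key ((E a - E b) / 2 / (|N b - N a| + 1)) (by apply div_pos _ hp; linarith)
  have h3 : (E a - E b) / 2 / (|N b - N a| + 1) * (N b - N a) ≤ (E a - E b) / 2 := by
    rw [div_mul_eq_mul_div, div_le_iff₀ hp]
    apply mul_le_mul_of_nonneg_left _ (by linarith)
    linarith [le_abs_self (N b - N a)]
  linarith

lemma ASaux_one (c d : ℝ) (hcd : c ≤ d) (h v : ℝ → ℝ)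
    (hc : ContinuousOn h (Set.Icc c d)) (ha : AntitoneOn h (Set.Icc c d))
    (hv : IntegrableOn v (Set.Icc c d))
    (hV : ∀ y ∈ Set.Icc c d, 0 ≤ ∫ t in Set.Ioc c y, v t) :
    h d * (∫ t in Set.Ioc c d, v t) ≤ ∫ t in Set.Ioc c d, h t * v t := by
  have hhv : IntegrableOn (fun t => h t * v t) (Set.Icc c d) :=
    hv.continuousOn_mul hc isCompact_Icc
  have split : ∀ u : ℝ → ℝ, IntegrableOn u (Set.Icc c d) → ∀ x ∈ Set.Icc c d, ∀ x' ∈ Set.Icc c d,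
      x ≤ x' → ∫ t in Set.Ioc c x', u t = (∫ t in Set.Ioc c x, u t) + ∫ t in Set.Ioc x x', u t := by
    intro u hu x hx x' hx' hxx
    rw [← Set.Ioc_union_Ioc_eq_Ioc hx.1 hxx]
    apply setIntegral_union (Set.Ioc_disjoint_Ioc_of_le le_rfl) measurableSet_Ioc
    · exact hu.mono_set fun t ht => ⟨ht.1.le, ht.2.trans hx.2⟩
    · exact hu.mono_set fun t ht => ⟨hx.1.trans ht.1.le, ht.2.trans hx'.2⟩
  have := ASaux_mono (fun x => (∫ t in Set.Ioc c x, h t * v t) - h x * ∫ t in Set.Ioc c x, v t)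
    (fun x => ∫ t in Set.Ioc c x, |v t|) c d hcd ?_
  · simp at this; linarith
  intro ε hε
  obtain ⟨δ, hδ, hu⟩ := Metric.uniformContinuousOn_iff.1
    (isCompact_Icc.uniformContinuousOn_of_continuous hc) ε hε
  refine ⟨δ, hδ, fun x hx x' hx' hxx hlt => ?_⟩
  have hsub : Set.Ioc x x' ⊆ Set.Icc c d := fun t ht => ⟨hx.1.trans ht.1.le, ht.2.trans hx'.2⟩
  rw [split _ hhv x hx x' hx' hxx, split _ hv x hx x' hx' hxx, split _ hv.abs x hx x' hx' hxx]
  have e1 : -ε * ∫ t in Set.Ioc x x', |v t| ≤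
      (∫ t in Set.Ioc x x', h t * v t) - h x' * ∫ t in Set.Ioc x x', v t := by
    rw [← MeasureTheory.integral_const_mul, ← MeasureTheory.integral_const_mul, ← MeasureTheory.integral_sub (hhv.mono_set hsub)
      ((hv.mono_set hsub).const_mul _)]
    apply setIntegral_mono_on (Integrable.const_mul (Integrable.abs (hv.mono_set hsub)) _)
      ((hhv.mono_set hsub).sub ((hv.mono_set hsub).const_mul _)) measurableSet_Ioc
    intro t ht
    have h1 := hu t (hsub ht) x' hx' (by
      rw [Real.dist_eq, abs_lt]; constructor <;> linarith [ht.1, ht.2])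
    rw [Real.dist_eq] at h1
    have h2 : |(h t - h x') * v t| ≤ ε * |v t| := by
      rw [abs_mul]; exact mul_le_mul_of_nonneg_right h1.le (abs_nonneg _)
    have := (abs_le.1 h2).1
    simp only [Pi.sub_apply]
    linarith
  have e2 : h x' * (∫ t in Set.Ioc c x, v t) ≤ h x * ∫ t in Set.Ioc c x, v t :=
    mul_le_mul_of_nonneg_right (ha hx hx' hxx) (hV x hx)
  linarith

lemma ASaux_two (a b c d : ℝ) (hab : a ≤ b) (hcd : c ≤ d)
    (f w : ℝ × ℝ → ℝ)
    (hf_cont : ContinuousOn f (Set.Icc a b ×ˢ Set.Icc c d))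
    (hf2d : ∀ a' ∈ Set.Icc a b, ∀ b' ∈ Set.Icc a b, ∀ c' ∈ Set.Icc c d, ∀ d' ∈ Set.Icc c d,
      a' ≤ b' → c' ≤ d' → 0 ≤ f (a', c') - f (a', d') - f (b', c') + f (b', d'))
    (hf_dec_x : ∀ y ∈ Set.Icc c d, AntitoneOn (fun x => f (x, y)) (Set.Icc a b))
    (hf_dec_y : ∀ x ∈ Set.Icc a b, AntitoneOn (fun y => f (x, y)) (Set.Icc c d))
    (hw : IntegrableOn w (Set.Icc a b ×ˢ Set.Icc c d))
    (hW : ∀ x ∈ Set.Icc a b, ∀ y ∈ Set.Icc c d, 0 ≤ ∫ p in Set.Ioc a x ×ˢ Set.Ioc c y, w p) :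
    f (b, d) * (∫ p in Set.Ioc a b ×ˢ Set.Ioc c d, w p) ≤
      ∫ p in Set.Ioc a b ×ˢ Set.Ioc c d, f p * w p := by
  have hK : IsCompact (Set.Icc a b ×ˢ Set.Icc c d) := isCompact_Icc.prod isCompact_Icc
  have hfw : IntegrableOn (fun p => f p * w p) (Set.Icc a b ×ˢ Set.Icc c d) :=
    hw.continuousOn_mul hf_cont hK
  have hcy : ∀ x ∈ Set.Icc a b, ContinuousOn (fun y => f (x, y)) (Set.Icc c d) := fun x hx =>
    hf_cont.comp (by fun_prop) fun y hy => ⟨hx, hy⟩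
  have hu_w : ∀ x ∈ Set.Icc a b,
      IntegrableOn (fun p => f (x, p.2) * w p) (Set.Icc a b ×ˢ Set.Icc c d) := fun x hx =>
    hw.continuousOn_mul ((hcy x hx).comp continuousOn_snd fun p hp => hp.2) hK
  have split : ∀ u : ℝ × ℝ → ℝ, IntegrableOn u (Set.Icc a b ×ˢ Set.Icc c d) →
      ∀ x ∈ Set.Icc a b, ∀ x' ∈ Set.Icc a b, x ≤ x' →
      ∫ t in Set.Ioc a x' ×ˢ Set.Ioc c d, u t =
      (∫ t in Set.Ioc a x ×ˢ Set.Ioc c d, u t) + ∫ t in Set.Ioc x x' ×ˢ Set.Ioc c d, u t := by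
    intro u hu x hx x' hx' hxx
    rw [← Set.Ioc_union_Ioc_eq_Ioc hx.1 hxx, Set.union_prod]
    apply setIntegral_union _ (measurableSet_Ioc.prod measurableSet_Ioc)
    · exact hu.mono_set fun t ht => ⟨⟨ht.1.1.le, ht.1.2.trans hx.2⟩, ⟨ht.2.1.le, ht.2.2⟩⟩
    · exact hu.mono_set fun t ht =>
        ⟨⟨hx.1.trans ht.1.1.le, ht.1.2.trans hx'.2⟩, ⟨ht.2.1.le, ht.2.2⟩⟩
    · exact Set.Disjoint.set_prod_left (Set.Ioc_disjoint_Ioc_of_le le_rfl) _ _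
  -- marginal
  have swap : ∀ u : ℝ × ℝ → ℝ, IntegrableOn u (Set.Icc a b ×ˢ Set.Icc c d) →
      ∀ x ∈ Set.Icc a b, ∀ y ∈ Set.Icc c d,
      ∫ p in Set.Ioc a x ×ˢ Set.Ioc c y, u p = ∫ t in Set.Ioc c y, ∫ s in Set.Ioc a x, u (s, t) := by
    intro u hu x hx y hy
    have hu' : IntegrableOn u (Set.Ioc a x ×ˢ Set.Ioc c y) := hu.mono_set fun t ht =>
      ⟨⟨ht.1.1.le, ht.1.2.trans hx.2⟩, ⟨ht.2.1.le, ht.2.2.trans hy.2⟩⟩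
    rw [IntegrableOn, Measure.volume_eq_prod, ← Measure.prod_restrict] at hu'
    rw [Measure.volume_eq_prod, ← Measure.prod_restrict]
    exact integral_prod_symm _ hu'
  -- one-dimensional inequality
  have one : ∀ x ∈ Set.Icc a b, ∀ h : ℝ → ℝ, ContinuousOn h (Set.Icc c d) →
      AntitoneOn h (Set.Icc c d) → h d * (∫ p in Set.Ioc a x ×ˢ Set.Ioc c d, w p) ≤
        ∫ p in Set.Ioc a x ×ˢ Set.Ioc c d, h p.2 * w p := by
    intro x hx h hc ha
    have hh : IntegrableOn (fun p => h p.2 * w p) (Set.Icc a b ×ˢ Set.Icc c d) :=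
      hw.continuousOn_mul (hc.comp continuousOn_snd fun p hp => hp.2) hK
    rw [swap _ hw x hx d ⟨hcd, le_rfl⟩, swap _ hh x hx d ⟨hcd, le_rfl⟩]
    simp only [MeasureTheory.integral_const_mul]
    apply ASaux_one c d hcd h _ hc ha
    · have hu' : IntegrableOn w (Set.Ioc a x ×ˢ Set.Icc c d) := hw.mono_set fun t ht =>
        ⟨⟨ht.1.1.le, ht.1.2.trans hx.2⟩, ht.2⟩
      rw [IntegrableOn, Measure.volume_eq_prod, ← Measure.prod_restrict] at hu'
      exact hu'.integral_prod_right
    · intro y hy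
      rw [← swap _ hw x hx y hy]
      exact hW x hx y hy
  have hb : b ∈ Set.Icc a b := ⟨hab, le_rfl⟩
  have hd : d ∈ Set.Icc c d := ⟨hcd, le_rfl⟩
  refine (one b hb (fun y => f (b, y)) (hcy b hb) (hf_dec_y b hb)).trans ?_
  have := ASaux_mono (fun x => (∫ p in Set.Ioc a x ×ˢ Set.Ioc c d, f p * w p)
      - ∫ p in Set.Ioc a x ×ˢ Set.Ioc c d, f (x, p.2) * w p)
    (fun x => ∫ p in Set.Ioc a x ×ˢ Set.Ioc c d, |w p|) a b hab ?_
  · simp at this; linarith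
  intro ε hε
  obtain ⟨δ, hδ, hu⟩ := Metric.uniformContinuousOn_iff.1
    (hK.uniformContinuousOn_of_continuous hf_cont) ε hε
  refine ⟨δ, hδ, fun x hx x' hx' hxx hlt => ?_⟩
  have hsub : Set.Ioc x x' ×ˢ Set.Ioc c d ⊆ Set.Icc a b ×ˢ Set.Icc c d := fun t ht =>
    ⟨⟨hx.1.trans ht.1.1.le, ht.1.2.trans hx'.2⟩, ⟨ht.2.1.le, ht.2.2⟩⟩
  have hsub2 : Set.Ioc a x ×ˢ Set.Ioc c d ⊆ Set.Icc a b ×ˢ Set.Icc c d := fun t ht =>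
    ⟨⟨ht.1.1.le, ht.1.2.trans hx.2⟩, ⟨ht.2.1.le, ht.2.2⟩⟩
  rw [split _ hfw x hx x' hx' hxx, split _ (hu_w x' hx') x hx x' hx' hxx,
    split _ hw.abs x hx x' hx' hxx]
  have e1 : -ε * ∫ p in Set.Ioc x x' ×ˢ Set.Ioc c d, |w p| ≤
      (∫ p in Set.Ioc x x' ×ˢ Set.Ioc c d, f p * w p)
        - ∫ p in Set.Ioc x x' ×ˢ Set.Ioc c d, f (x', p.2) * w p := by
    rw [← MeasureTheory.integral_const_mul, ← MeasureTheory.integral_sub (hfw.mono_set hsub)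
      ((hu_w x' hx').mono_set hsub)]
    apply setIntegral_mono_on (Integrable.const_mul (Integrable.abs (hw.mono_set hsub)) _)
      ((hfw.mono_set hsub).sub ((hu_w x' hx').mono_set hsub))
      (measurableSet_Ioc.prod measurableSet_Ioc)
    intro p hp
    have h1 := hu p (hsub hp) (x', p.2) ⟨hx', (hsub hp).2⟩ (by
      rw [Prod.dist_eq, dist_self, max_eq_left dist_nonneg, Real.dist_eq, abs_lt]
      constructor <;> linarith [hp.1.1, hp.1.2])
    rw [Real.dist_eq] at h1
    have h2 : |(f p - f (x', p.2)) * w p| ≤ ε * |w p| := by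
      rw [abs_mul]; exact mul_le_mul_of_nonneg_right h1.le (abs_nonneg _)
    have := (abs_le.1 h2).1
    simp only [Pi.sub_apply]
    linarith
  have e2 : (∫ p in Set.Ioc a x ×ˢ Set.Ioc c d, f (x', p.2) * w p) ≤
      ∫ p in Set.Ioc a x ×ˢ Set.Ioc c d, f (x, p.2) * w p := by
    have h1 := one x hx (fun y => f (x, y) - f (x', y)) ((hcy x hx).sub (hcy x' hx')) (by
      intro y hy y' hy' hyy
      have := hf2d x hx x' hx' y hy y' hy' hxx hyy
      simp only; linarith)
    have h2 : 0 ≤ (f (x, d) - f (x', d)) * ∫ p in Set.Ioc a x ×ˢ Set.Ioc c d, w p :=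
      mul_nonneg (sub_nonneg.2 (hf_dec_x d hd hx hx' hxx)) (hW x hx d hd)
    simp only [sub_mul] at h1 h2
    rw [MeasureTheory.integral_sub ((hu_w x hx).mono_set hsub2) ((hu_w x' hx').mono_set hsub2)] at h1
    linarith
  linarith

/-- Abel–Steffensen integral inequality under Carathéodory absolute continuity
(Remark 2 of the paper): if `f` is nonnegative, continuous, 2d-monotone decreasing and
admits the representation
`f(x,y) = f(a,c) + ∫_a^x g₁ + ∫_c^y g₂ + ∫_a^x ∫_c^y g` with integrable `g₁, g₂, g`,
and `w` is integrable with `W x y = ∫_a^x ∫_c^y w(s,t) dt ds ≥ 0`, then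
`∫_a^b ∫_c^d f w ≥ f(b,d) W(b,d)`. -/
theorem abel_steffensen_integral_caratheodory
    (a b c d : ℝ) (hab : a ≤ b) (hcd : c ≤ d)
    (f w : ℝ → ℝ → ℝ) (g₁ g₂ : ℝ → ℝ) (g : ℝ → ℝ → ℝ)
    (hf_nonneg : ∀ x ∈ Set.Icc a b, ∀ y ∈ Set.Icc c d, 0 ≤ f x y)
    (hf_cont : ContinuousOn (fun p : ℝ × ℝ => f p.1 p.2) (Set.Icc a b ×ˢ Set.Icc c d))
    (hf2d : ∀ a' ∈ Set.Icc a b, ∀ b' ∈ Set.Icc a b, ∀ c' ∈ Set.Icc c d, ∀ d' ∈ Set.Icc c d,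
      a' ≤ b' → c' ≤ d' → 0 ≤ f a' c' - f a' d' - f b' c' + f b' d')
    (hf_dec_x : ∀ y ∈ Set.Icc c d, AntitoneOn (fun x => f x y) (Set.Icc a b))
    (hf_dec_y : ∀ x ∈ Set.Icc a b, AntitoneOn (fun y => f x y) (Set.Icc c d))
    (hg₁ : IntegrableOn g₁ (Set.Icc a b))
    (hg₂ : IntegrableOn g₂ (Set.Icc c d))
    (hg : IntegrableOn (fun p : ℝ × ℝ => g p.1 p.2) (Set.Icc a b ×ˢ Set.Icc c d))
    (hrep : ∀ x ∈ Set.Icc a b, ∀ y ∈ Set.Icc c d,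
      f x y = f a c + (∫ s in a..x, g₁ s) + (∫ t in c..y, g₂ t)
        + ∫ s in a..x, ∫ t in c..y, g s t)
    (hw : IntegrableOn (fun p : ℝ × ℝ => w p.1 p.2) (Set.Icc a b ×ˢ Set.Icc c d))
    (hW : ∀ x ∈ Set.Icc a b, ∀ y ∈ Set.Icc c d, 0 ≤ ∫ s in a..x, ∫ t in c..y, w s t) :
    f b d * (∫ s in a..b, ∫ t in c..d, w s t) ≤
      ∫ x in a..b, ∫ y in c..d, f x y * w x y := by
  have conv : ∀ u : ℝ × ℝ → ℝ, IntegrableOn u (Set.Icc a b ×ˢ Set.Icc c d) →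
      ∀ x ∈ Set.Icc a b, ∀ y ∈ Set.Icc c d,
      ∫ s in a..x, ∫ t in c..y, u (s, t) = ∫ p in Set.Ioc a x ×ˢ Set.Ioc c y, u p := by
    intro u hu x hx y hy
    have hu' : IntegrableOn u (Set.Ioc a x ×ˢ Set.Ioc c y) := hu.mono_set fun t ht =>
      ⟨⟨ht.1.1.le, ht.1.2.trans hx.2⟩, ⟨ht.2.1.le, ht.2.2.trans hy.2⟩⟩
    rw [Measure.volume_eq_prod] at hu'
    rw [Measure.volume_eq_prod, setIntegral_prod _ hu', intervalIntegral.integral_of_le hx.1]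
    simp only [intervalIntegral.integral_of_le hy.1]
  have hb : b ∈ Set.Icc a b := ⟨hab, le_rfl⟩
  have hd : d ∈ Set.Icc c d := ⟨hcd, le_rfl⟩
  have hfw : IntegrableOn (fun p : ℝ × ℝ => f p.1 p.2 * w p.1 p.2)
      (Set.Icc a b ×ˢ Set.Icc c d) :=
    hw.continuousOn_mul hf_cont (isCompact_Icc.prod isCompact_Icc)
  have c1 := conv _ hw b hb d hd
  have c2 := conv _ hfw b hb d hd
  simp only at c1 c2
  rw [c1, c2]
  refine ASaux_two a b c d hab hcd (fun p => f p.1 p.2) (fun p => w p.1 p.2) hf_cont hf2d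
    hf_dec_x hf_dec_y hw fun x hx y hy => ?_
  rw [← conv _ hw x hx y hy]
  exact hW x hx y hy
end

section
/- Let f be a twice continuously differentiable real-valued function on [a,b] × [c,d] (with continuous mixed partial derivative ∂²f/∂x∂y) and let w be a continuous real-valued function on [a,b] × [c,d]. Define W̃(x,y) = ∫_x^b ∫_y^d w(s,t) dt ds. Then ∫_a^b ∫_c^d f(x,y) w(x,y) dy dx = f(a,c) W̃(a,c) + ∫_a^b W̃(x,c) (∂f/∂x)(x,c) dx + ∫_c^d W̃(a,y) (∂f/∂y)(a,y) dy + ∫_a^b ∫_c^d W̃(x,y) (∂²f/∂x∂y)(x,y) dy dx. -/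
open intervalIntegral

theorem aux_integrable {a b c d : ℝ} (hab : a ≤ b) (hcd : c ≤ d) {G : ℝ → ℝ → ℝ}
    (hG : ContinuousOn (fun p : ℝ × ℝ => G p.1 p.2) (Set.Icc a b ×ˢ Set.Icc c d)) :
    MeasureTheory.Integrable (Function.uncurry G)
      ((MeasureTheory.volume.restrict (Set.Ioc a b)).prod
        (MeasureTheory.volume.restrict (Set.Ioc c d))) := by
  rw [MeasureTheory.Measure.prod_restrict]
  have h := hG.integrableOn_compact (μ := MeasureTheory.volume) (isCompact_Icc.prod isCompact_Icc)
  exact MeasureTheory.IntegrableOn.mono_set h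
    (Set.prod_mono Set.Ioc_subset_Icc_self Set.Ioc_subset_Icc_self)

theorem aux_swap {a b c d : ℝ} (hab : a ≤ b) (hcd : c ≤ d) {G : ℝ → ℝ → ℝ}
    (hG : ContinuousOn (fun p : ℝ × ℝ => G p.1 p.2) (Set.Icc a b ×ˢ Set.Icc c d)) :
    ∫ x in a..b, ∫ y in c..d, G x y = ∫ y in c..d, ∫ x in a..b, G x y := by
  simp only [integral_of_le hab, integral_of_le hcd]
  exact MeasureTheory.integral_integral_swap (aux_integrable hab hcd hG)

theorem aux_int_left {a b c d : ℝ} (hab : a ≤ b) (hcd : c ≤ d) {G : ℝ → ℝ → ℝ}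
    (hG : ContinuousOn (fun p : ℝ × ℝ => G p.1 p.2) (Set.Icc a b ×ˢ Set.Icc c d)) :
    IntervalIntegrable (fun x => ∫ y in c..d, G x y) MeasureTheory.volume a b := by
  rw [intervalIntegrable_iff_integrableOn_Ioc_of_le hab]
  simp only [integral_of_le hcd]
  exact (aux_integrable hab hcd hG).integral_prod_left

theorem aux_int_right {a b c d : ℝ} (hab : a ≤ b) (hcd : c ≤ d) {G : ℝ → ℝ → ℝ}
    (hG : ContinuousOn (fun p : ℝ × ℝ => G p.1 p.2) (Set.Icc a b ×ˢ Set.Icc c d)) :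
    IntervalIntegrable (fun y => ∫ x in a..b, G x y) MeasureTheory.volume c d := by
  rw [intervalIntegrable_iff_integrableOn_Ioc_of_le hcd]
  simp only [integral_of_le hab]
  exact (aux_integrable hab hcd hG).integral_prod_right

theorem aux_one {a b : ℝ} (hab : a ≤ b) {g g' u : ℝ → ℝ}
    (hg : ∀ x ∈ Set.Icc a b, HasDerivAt g (g' x) x) (hg' : ContinuousOn g' (Set.Icc a b))
    (hu : Continuous u) :
    ∫ x in a..b, g x * u x = g a * (∫ x in a..b, u x) + ∫ x in a..b, (∫ s in x..b, u s) * g' x := by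
  have h := integral_mul_deriv_eq_deriv_mul (a := a) (b := b) (u := g) (u' := g')
    (v := fun x => -∫ s in x..b, u s) (v' := u)
    (by rwa [Set.uIcc_of_le hab])
    (fun x _ => by
      have := (integral_hasDerivAt_left (hu.intervalIntegrable x b)
        (hu.stronglyMeasurableAtFilter _ _) hu.continuousAt).neg
      rw [neg_neg] at this
      exact this)
    (ContinuousOn.intervalIntegrable (by rwa [Set.uIcc_of_le hab])) (hu.intervalIntegrable a b)
  rw [h]
  have e : ∫ x in a..b, g' x * -∫ s in x..b, u s = -∫ x in a..b, (∫ s in x..b, u s) * g' x := by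
    rw [← intervalIntegral.integral_neg]
    congr 1
    funext x
    ring
  rw [e, integral_same]
  ring

theorem aux_V {w : ℝ → ℝ → ℝ} (hw : Continuous (fun p : ℝ × ℝ => w p.1 p.2)) (d : ℝ) :
    Continuous (fun p : ℝ × ℝ => ∫ t in p.2..d, w p.1 t) := by
  have h : Continuous (fun p : ℝ × ℝ => ∫ t in d..p.2, w p.1 t) :=
    continuous_parametric_intervalIntegral_of_continuous
      (f := fun (p : ℝ × ℝ) t => w p.1 t)
      (hw.comp ((continuous_fst.comp continuous_fst).prodMk continuous_snd)) continuous_snd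
  have e : (fun p : ℝ × ℝ => ∫ t in p.2..d, w p.1 t) = fun p => -∫ t in d..p.2, w p.1 t := by
    funext p
    exact integral_symm _ _
  rw [e]
  exact h.neg

theorem aux_W {V : ℝ → ℝ → ℝ} (hV : Continuous (fun p : ℝ × ℝ => V p.1 p.2)) (b : ℝ) :
    Continuous (fun p : ℝ × ℝ => ∫ s in p.1..b, V s p.2) :=
  (aux_V (w := fun x y => V y x) (hV.comp continuous_swap) b).comp continuous_swap

theorem aux_core
    (a b c d : ℝ) (hab : a < b) (hcd : c < d)
    (f fx fy fxy w : ℝ → ℝ → ℝ)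
    (hfx : ∀ x ∈ Set.Icc a b, ∀ y ∈ Set.Icc c d, HasDerivAt (fun x' => f x' y) (fx x y) x)
    (hfy : ∀ x ∈ Set.Icc a b, ∀ y ∈ Set.Icc c d, HasDerivAt (fun y' => f x y') (fy x y) y)
    (hfxy : ∀ x ∈ Set.Icc a b, ∀ y ∈ Set.Icc c d, HasDerivAt (fun x' => fy x' y) (fxy x y) x)
    (hfx_cont : ContinuousOn (fun p : ℝ × ℝ => fx p.1 p.2) (Set.Icc a b ×ˢ Set.Icc c d))
    (hfy_cont : ContinuousOn (fun p : ℝ × ℝ => fy p.1 p.2) (Set.Icc a b ×ˢ Set.Icc c d))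
    (hfxy_cont : ContinuousOn (fun p : ℝ × ℝ => fxy p.1 p.2) (Set.Icc a b ×ˢ Set.Icc c d))
    (hw : Continuous (fun p : ℝ × ℝ => w p.1 p.2)) :
    ∫ x in a..b, ∫ y in c..d, f x y * w x y =
      f a c * (∫ s in a..b, ∫ t in c..d, w s t)
      + (∫ x in a..b, (∫ s in x..b, ∫ t in c..d, w s t) * fx x c)
      + (∫ y in c..d, (∫ s in a..b, ∫ t in y..d, w s t) * fy a y)
      + ∫ x in a..b, ∫ y in c..d, (∫ s in x..b, ∫ t in y..d, w s t) * fxy x y := by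
  have hV := aux_V hw d
  have hW := aux_W (V := fun x y => ∫ t in y..d, w x t) hV b
  have hc : c ∈ Set.Icc c d := ⟨le_rfl, hcd.le⟩
  have ha : a ∈ Set.Icc a b := ⟨le_rfl, hab.le⟩
  have sx : ∀ {G : ℝ → ℝ → ℝ},
      ContinuousOn (fun p : ℝ × ℝ => G p.1 p.2) (Set.Icc a b ×ˢ Set.Icc c d) →
      ∀ x ∈ Set.Icc a b, ContinuousOn (fun y => G x y) (Set.Icc c d) := fun h x hx =>
    h.comp (f := fun y => (x, y)) (by fun_prop) (fun y hy => ⟨hx, hy⟩)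
  have sy : ∀ {G : ℝ → ℝ → ℝ},
      ContinuousOn (fun p : ℝ × ℝ => G p.1 p.2) (Set.Icc a b ×ˢ Set.Icc c d) →
      ∀ y ∈ Set.Icc c d, ContinuousOn (fun x => G x y) (Set.Icc a b) := fun h y hy =>
    h.comp (f := fun x => (x, y)) (by fun_prop) (fun x hx => ⟨hx, hy⟩)
  have hVy : ∀ y, Continuous (fun x => ∫ t in y..d, w x t) := fun y =>
    hV.comp (by fun_prop : Continuous fun x : ℝ => (x, y))
  have hwx : ∀ x, Continuous (fun y => w x y) := fun x =>
    hw.comp (by fun_prop : Continuous fun y : ℝ => (x, y))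
  have hVfy : ContinuousOn (fun p : ℝ × ℝ => (∫ t in p.2..d, w p.1 t) * fy p.1 p.2)
    (Set.Icc a b ×ˢ Set.Icc c d) := hV.continuousOn.mul hfy_cont
  have hWf : ContinuousOn (fun p : ℝ × ℝ => (∫ s in p.1..b, ∫ t in p.2..d, w s t) * fxy p.1 p.2)
    (Set.Icc a b ×ˢ Set.Icc c d) := hW.continuousOn.mul hfxy_cont
  have e1 : ∫ x in a..b, ∫ y in c..d, f x y * w x y =
      ∫ x in a..b, (f x c * (∫ t in c..d, w x t) +
        ∫ y in c..d, (∫ t in y..d, w x t) * fy x y) := by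
    apply integral_congr
    intro x hx
    rw [Set.uIcc_of_le hab.le] at hx
    exact aux_one hcd.le (hfy x hx) (sx hfy_cont x hx) (hwx x)
  have hfc : ContinuousOn (fun x => f x c) (Set.Icc a b) := fun x hx =>
    (hfx x hx c hc).continuousAt.continuousWithinAt
  rw [e1, intervalIntegral.integral_add
    (ContinuousOn.intervalIntegrable (by
      rw [Set.uIcc_of_le hab.le]; exact hfc.mul (hVy c).continuousOn))
    (aux_int_left (G := fun x y => (∫ t in y..d, w x t) * fy x y) hab.le hcd.le hVfy),
    aux_one hab.le (fun x hx => hfx x hx c hc) (sy hfx_cont c hc) (hVy c),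
    aux_swap (G := fun x y => (∫ t in y..d, w x t) * fy x y) hab.le hcd.le hVfy,
    aux_swap (G := fun x y => (∫ s in x..b, ∫ t in y..d, w s t) * fxy x y) hab.le hcd.le hWf]
  have e2 : ∫ y in c..d, ∫ x in a..b, (∫ t in y..d, w x t) * fy x y =
      ∫ y in c..d, ((∫ s in a..b, ∫ t in y..d, w s t) * fy a y +
        ∫ x in a..b, (∫ s in x..b, ∫ t in y..d, w s t) * fxy x y) := by
    apply integral_congr
    intro y hy
    rw [Set.uIcc_of_le hcd.le] at hy
    have := aux_one hab.le (fun x hx => hfxy x hx y hy) (sy hfxy_cont y hy) (hVy y)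
    simp only [mul_comm (fy _ _)] at this
    exact this
  have hWa : Continuous (fun y => ∫ s in a..b, ∫ t in y..d, w s t) :=
    hW.comp (by fun_prop : Continuous fun y : ℝ => (a, y))
  rw [e2, intervalIntegral.integral_add
    (ContinuousOn.intervalIntegrable (by
      rw [Set.uIcc_of_le hcd.le]; exact hWa.continuousOn.mul (sx hfy_cont a ha)))
    (aux_int_right (G := fun x y => (∫ s in x..b, ∫ t in y..d, w s t) * fxy x y)
      hab.le hcd.le hWf)]
  ring

/-- Young's identity (Y2) for double integrals on a rectangle `[a,b] × [c,d]`.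
Here `fx = ∂f/∂x`, `fy = ∂f/∂y`, `fxy = ∂²f/∂x∂y` and
`W̃ x y = ∫_x^b ∫_y^d w(s,t) dt ds`. -/
theorem young_identity_Y2
    (a b c d : ℝ) (hab : a < b) (hcd : c < d)
    (f fx fy fxy w : ℝ → ℝ → ℝ)
    (hfx : ∀ x ∈ Set.Icc a b, ∀ y ∈ Set.Icc c d, HasDerivAt (fun x' => f x' y) (fx x y) x)
    (hfy : ∀ x ∈ Set.Icc a b, ∀ y ∈ Set.Icc c d, HasDerivAt (fun y' => f x y') (fy x y) y)
    (hfxy : ∀ x ∈ Set.Icc a b, ∀ y ∈ Set.Icc c d, HasDerivAt (fun x' => fy x' y) (fxy x y) x)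
    (hf_cont : ContinuousOn (fun p : ℝ × ℝ => f p.1 p.2) (Set.Icc a b ×ˢ Set.Icc c d))
    (hfx_cont : ContinuousOn (fun p : ℝ × ℝ => fx p.1 p.2) (Set.Icc a b ×ˢ Set.Icc c d))
    (hfy_cont : ContinuousOn (fun p : ℝ × ℝ => fy p.1 p.2) (Set.Icc a b ×ˢ Set.Icc c d))
    (hfxy_cont : ContinuousOn (fun p : ℝ × ℝ => fxy p.1 p.2) (Set.Icc a b ×ˢ Set.Icc c d))
    (hw_cont : ContinuousOn (fun p : ℝ × ℝ => w p.1 p.2) (Set.Icc a b ×ˢ Set.Icc c d)) :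
    ∫ x in a..b, ∫ y in c..d, f x y * w x y =
      f a c * (∫ s in a..b, ∫ t in c..d, w s t)
      + (∫ x in a..b, (∫ s in x..b, ∫ t in c..d, w s t) * fx x c)
      + (∫ y in c..d, (∫ s in a..b, ∫ t in y..d, w s t) * fy a y)
      + ∫ x in a..b, ∫ y in c..d, (∫ s in x..b, ∫ t in y..d, w s t) * fxy x y := by

  set w' : ℝ → ℝ → ℝ := fun x y =>
    w (Set.projIcc a b hab.le x) (Set.projIcc c d hcd.le y) with hw'
  have hcont : Continuous (fun p : ℝ × ℝ => w' p.1 p.2) :=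
    hw_cont.comp_continuous
      (f := fun p : ℝ × ℝ => ((Set.projIcc a b hab.le p.1 : ℝ), (Set.projIcc c d hcd.le p.2 : ℝ)))
      ((continuous_subtype_val.comp (continuous_projIcc.comp continuous_fst)).prodMk
        (continuous_subtype_val.comp (continuous_projIcc.comp continuous_snd)))
      (fun p => ⟨Subtype.mem _, Subtype.mem _⟩)
  have heq : ∀ x ∈ Set.Icc a b, ∀ y ∈ Set.Icc c d, w' x y = w x y := fun x hx y hy => by
    simp only [hw', Set.projIcc_of_mem hab.le hx, Set.projIcc_of_mem hcd.le hy]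
  have hW : ∀ x ∈ Set.Icc a b, ∀ y ∈ Set.Icc c d,
      ∫ s in x..b, ∫ t in y..d, w' s t = ∫ s in x..b, ∫ t in y..d, w s t := by
    intro x hx y hy
    apply integral_congr
    intro s hs
    apply integral_congr
    intro t ht
    rw [Set.uIcc_of_le hx.2] at hs
    rw [Set.uIcc_of_le hy.2] at ht
    exact heq s ⟨hx.1.trans hs.1, hs.2⟩ t ⟨hy.1.trans ht.1, ht.2⟩
  have hc : c ∈ Set.Icc c d := ⟨le_rfl, hcd.le⟩
  have ha : a ∈ Set.Icc a b := ⟨le_rfl, hab.le⟩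
  have key := aux_core a b c d hab hcd f fx fy fxy w' hfx hfy hfxy hfx_cont hfy_cont hfxy_cont hcont
  have e0 : ∫ x in a..b, ∫ y in c..d, f x y * w' x y =
      ∫ x in a..b, ∫ y in c..d, f x y * w x y := by
    apply integral_congr
    intro x hx
    apply integral_congr
    intro y hy
    rw [Set.uIcc_of_le hab.le] at hx
    rw [Set.uIcc_of_le hcd.le] at hy
    simp only [heq x hx y hy]
  have e1 : ∫ x in a..b, (∫ s in x..b, ∫ t in c..d, w' s t) * fx x c =
      ∫ x in a..b, (∫ s in x..b, ∫ t in c..d, w s t) * fx x c := by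
    apply integral_congr
    intro x hx
    rw [Set.uIcc_of_le hab.le] at hx
    simp only [hW x hx c hc]
  have e2 : ∫ y in c..d, (∫ s in a..b, ∫ t in y..d, w' s t) * fy a y =
      ∫ y in c..d, (∫ s in a..b, ∫ t in y..d, w s t) * fy a y := by
    apply integral_congr
    intro y hy
    rw [Set.uIcc_of_le hcd.le] at hy
    simp only [hW a ha y hy]
  have e3 : ∫ x in a..b, ∫ y in c..d, (∫ s in x..b, ∫ t in y..d, w' s t) * fxy x y =
      ∫ x in a..b, ∫ y in c..d, (∫ s in x..b, ∫ t in y..d, w s t) * fxy x y := by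
    apply integral_congr
    intro x hx
    apply integral_congr
    intro y hy
    rw [Set.uIcc_of_le hab.le] at hx
    rw [Set.uIcc_of_le hcd.le] at hy
    simp only [hW x hx y hy]
  rw [e0, hW a ha c hc, e1, e2, e3] at key
  exact key
end

section
/- Let f and w be real-valued functions on [a,b] × [c,d] such that: (i) f is nonnegative, continuously differentiable and 2d-monotone increasing; (ii) w is integrable and W̃(x,y) = ∫_x^b ∫_y^d w(s,t) dt ds ≥ 0 for all (x,y) ∈ [a,b] × [c,d]. Then ∫_a^b ∫_c^d f(x,y) w(x,y) dy dx ≥ f(a,c) W̃(a,c). -/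
open intervalIntegral MeasureTheory

lemma as_tele1 (u : ℕ → ℝ) (k n : ℕ) (h : k ≤ n) :
    ∑ i ∈ Finset.range n, (u (i+1) - u i) * (if i < k then 1 else 0) = u k - u 0 := by
  simp only [mul_ite, mul_one, mul_zero]
  rw [← Finset.sum_filter]
  have : (Finset.range n).filter (fun i => i < k) = Finset.range k := by
    ext i; simp; omega
  rw [this, Finset.sum_range_sub]

lemma as_tele2 (F : ℕ → ℕ → ℝ) (k l n : ℕ) (h : k ≤ n) (h' : l ≤ n) :
    F k l = F 0 0 + ∑ i ∈ Finset.range n, (F (i+1) 0 - F i 0) * (if i < k then 1 else 0)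
      + ∑ j ∈ Finset.range n, (F 0 (j+1) - F 0 j) * (if j < l then 1 else 0)
      + ∑ i ∈ Finset.range n, ∑ j ∈ Finset.range n,
        (F i j - F i (j+1) - F (i+1) j + F (i+1) (j+1)) *
          ((if i < k then 1 else 0) * (if j < l then 1 else 0)) := by
  have h1 := as_tele1 (fun i => F i 0) k n h
  have h2 := as_tele1 (fun j => F 0 j) l n h'
  have h3 : ∑ i ∈ Finset.range n, ∑ j ∈ Finset.range n,
        (F i j - F i (j+1) - F (i+1) j + F (i+1) (j+1)) *
          ((if i < k then (1:ℝ) else 0) * (if j < l then 1 else 0))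
      = (F k l - F k 0) - (F 0 l - F 0 0) := by
    rw [← as_tele1 (fun i => F i l - F i 0) k n h]
    refine Finset.sum_congr rfl fun i _ => ?_
    have := as_tele1 (fun j => F (i+1) j - F i j) l n h'
    have e : F (i + 1) l - F (i + 1) 0 - (F i l - F i 0)
      = F (i+1) l - F i l - (F (i+1) 0 - F i 0) := by ring
    simp only [e]
    rw [← this, Finset.sum_mul]
    refine Finset.sum_congr rfl fun j _ => ?_
    ring
  rw [h3]
  rw [h1, h2]; ring

/-- index of the left grid point strictly below `x` -/
noncomputable def asK (a h x : ℝ) : ℕ := ⌈(x - a) / h⌉₊ - 1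

lemma as_lt_K (a h x : ℝ) (hh : 0 < h) (i : ℕ) : i < asK a h x ↔ a + ((i + 1 : ℕ) : ℝ) * h < x := by
  have : i < asK a h x ↔ i + 1 < ⌈(x - a) / h⌉₊ := by unfold asK; omega
  rw [this, Nat.lt_ceil, lt_div_iff₀ hh]
  constructor <;> intro h <;> linarith

lemma as_K_le (a h x : ℝ) (hh : 0 < h) (n : ℕ) (hx : x ≤ a + n * h) : asK a h x ≤ n := by
  have : ⌈(x - a) / h⌉₊ ≤ n := by
    rw [Nat.ceil_le, div_le_iff₀ hh]; linarith
  unfold asK; omega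

lemma as_K_bd (a h x : ℝ) (hh : 0 < h) (hx : a < x) :
    x - h ≤ a + asK a h x * h ∧ a + asK a h x * h ≤ x := by
  have hp : 0 < (x - a) / h := div_pos (by linarith) hh
  have h1 : 0 < ⌈(x - a) / h⌉₊ := Nat.ceil_pos.2 hp
  have h2 : ((asK a h x : ℕ) : ℝ) + 1 = (⌈(x - a) / h⌉₊ : ℝ) := by
    have : asK a h x + 1 = ⌈(x - a) / h⌉₊ := by unfold asK; omega
    exact_mod_cast this
  have h3 := Nat.le_ceil ((x - a) / h)
  have h4 := Nat.ceil_lt_add_one hp.le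
  rw [← h2] at h3 h4
  rw [div_le_iff₀ hh] at h3
  have h5 : (asK a h x : ℝ) < (x - a) / h := by linarith
  rw [lt_div_iff₀ hh] at h5
  constructor <;> linarith

lemma as_iter (a b c d p q : ℝ) (hp : p ∈ Set.Icc a b) (hq : q ∈ Set.Icc c d) (w : ℝ → ℝ → ℝ)
    (hw : IntegrableOn (fun p : ℝ × ℝ => w p.1 p.2) (Set.Ioc a b ×ˢ Set.Ioc c d)) :
    ∫ z in Set.Ioc a b ×ˢ Set.Ioc c d, (Set.Ioi p ×ˢ Set.Ioi q).indicator
      (fun z : ℝ × ℝ => w z.1 z.2) z = ∫ s in p..b, ∫ t in q..d, w s t := by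
  rw [setIntegral_indicator (measurableSet_Ioi.prod measurableSet_Ioi), Set.prod_inter_prod,
    Set.Ioc_inter_Ioi, Set.Ioc_inter_Ioi, sup_eq_right.2 hp.1, sup_eq_right.2 hq.1,
    Measure.volume_eq_prod, setIntegral_prod, integral_of_le hp.2]
  · simp only [integral_of_le hq.2]
  · exact hw.mono_set (Set.prod_mono (Set.Ioc_subset_Ioc_left hp.1) (Set.Ioc_subset_Ioc_left hq.1))

lemma as_step (a b c d : ℝ) (hab : a < b) (hcd : c < d)
    (f w : ℝ → ℝ → ℝ)
    (hf2d : ∀ a' ∈ Set.Icc a b, ∀ b' ∈ Set.Icc a b, ∀ c' ∈ Set.Icc c d, ∀ d' ∈ Set.Icc c d,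
      a' ≤ b' → c' ≤ d' → 0 ≤ f a' c' - f a' d' - f b' c' + f b' d')
    (hf_inc_x : ∀ y ∈ Set.Icc c d, MonotoneOn (fun x => f x y) (Set.Icc a b))
    (hf_inc_y : ∀ x ∈ Set.Icc a b, MonotoneOn (fun y => f x y) (Set.Icc c d))
    (hw : IntegrableOn (fun p : ℝ × ℝ => w p.1 p.2) (Set.Ioc a b ×ˢ Set.Ioc c d))
    (hW : ∀ x ∈ Set.Icc a b, ∀ y ∈ Set.Icc c d, 0 ≤ ∫ s in x..b, ∫ t in y..d, w s t)
    (n : ℕ) (hn : 0 < n) :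
    IntegrableOn (fun z : ℝ × ℝ => f (a + asK a ((b-a)/n) z.1 * ((b-a)/n))
        (c + asK c ((d-c)/n) z.2 * ((d-c)/n)) * w z.1 z.2) (Set.Ioc a b ×ˢ Set.Ioc c d) ∧
    f a c * (∫ s in a..b, ∫ t in c..d, w s t) ≤
      ∫ z in Set.Ioc a b ×ˢ Set.Ioc c d, f (a + asK a ((b-a)/n) z.1 * ((b-a)/n))
        (c + asK c ((d-c)/n) z.2 * ((d-c)/n)) * w z.1 z.2 := by
  have hn' : (0:ℝ) < n := by exact_mod_cast hn
  set h := (b-a)/n with hh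
  set g := (d-c)/n with hg
  have hpos : 0 < h := div_pos (by linarith) hn'
  have gpos : 0 < g := div_pos (by linarith) hn'
  have hb : a + n * h = b := by rw [hh]; field_simp; ring
  have hd : c + n * g = d := by rw [hg]; field_simp; ring
  set X : ℕ → ℝ := fun i => a + i * h with hX
  set Y : ℕ → ℝ := fun i => c + i * g with hY
  have X0 : X 0 = a := by simp [hX]
  have Y0 : Y 0 = c := by simp [hY]
  have Xm : ∀ i ≤ n, X i ∈ Set.Icc a b := by
    intro i hi
    have : (i:ℝ) ≤ n := by exact_mod_cast hi
    have h1 := mul_le_mul_of_nonneg_right this hpos.le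
    have h2 : 0 ≤ (i:ℝ) * h := by positivity
    constructor <;> simp only [hX] <;> linarith
  have Ym : ∀ i ≤ n, Y i ∈ Set.Icc c d := by
    intro i hi
    have : (i:ℝ) ≤ n := by exact_mod_cast hi
    have h1 := mul_le_mul_of_nonneg_right this gpos.le
    have h2 : 0 ≤ (i:ℝ) * g := by positivity
    constructor <;> simp only [hY] <;> linarith
  have Xs : ∀ i, X i ≤ X (i+1) := by
    intro i; simp only [hX]; push_cast; linarith
  have Ys : ∀ i, Y i ≤ Y (i+1) := by
    intro i; simp only [hY]; push_cast; linarith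
  set G : ℝ → ℝ → ℝ × ℝ → ℝ := fun p q => (Set.Ioi p ×ˢ Set.Ioi q).indicator
      (fun z : ℝ × ℝ => w z.1 z.2) with hG
  have Gi : ∀ p q, Integrable (G p q) (volume.restrict (Set.Ioc a b ×ˢ Set.Ioc c d)) := by
    intro p q
    exact hw.integrable.indicator (measurableSet_Ioi.prod measurableSet_Ioi)
  have Gv : ∀ p ∈ Set.Icc a b, ∀ q ∈ Set.Icc c d, ∫ z in Set.Ioc a b ×ˢ Set.Ioc c d, G p q z
      = ∫ s in p..b, ∫ t in q..d, w s t := fun p hp q hq => as_iter a b c d p q hp hq w hw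
  have mR : MeasurableSet (Set.Ioc a b ×ˢ Set.Ioc c d) := measurableSet_Ioc.prod measurableSet_Ioc
  set S1 : ℝ × ℝ → ℝ := fun z => ∑ i ∈ Finset.range n, (f (X (i+1)) c - f (X i) c) * G (X (i+1)) c z with hS1
  set S2 : ℝ × ℝ → ℝ := fun z => ∑ j ∈ Finset.range n, (f a (Y (j+1)) - f a (Y j)) * G a (Y (j+1)) z with hS2
  set S3 : ℝ × ℝ → ℝ := fun z => ∑ i ∈ Finset.range n, ∑ j ∈ Finset.range n,
    (f (X i) (Y j) - f (X i) (Y (j+1)) - f (X (i+1)) (Y j) + f (X (i+1)) (Y (j+1))) *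
      G (X (i+1)) (Y (j+1)) z with hS3
  have E : Set.EqOn (fun z : ℝ × ℝ => f (X (asK a h z.1)) (Y (asK c g z.2)) * w z.1 z.2)
      (fun z => f a c * G a c z + S1 z + S2 z + S3 z) (Set.Ioc a b ×ˢ Set.Ioc c d) := by
    rintro ⟨x, y⟩ ⟨hx, hy⟩
    simp only at hx hy
    have hk := as_K_le a h x hpos n (by rw [hb]; exact hx.2)
    have hl := as_K_le c g y gpos n (by rw [hd]; exact hy.2)
    have ex : ∀ i, (i < asK a h x ↔ X (i+1) < x) := as_lt_K a h x hpos
    have ey : ∀ i, (i < asK c g y ↔ Y (i+1) < y) := as_lt_K c g y gpos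
    have GG : ∀ p q, G p q (x, y) = (if p < x then 1 else 0) * (if q < y then 1 else 0) * w x y := by
      intro p q
      by_cases h1 : p < x <;> by_cases h2 : q < y <;> simp [hG, Set.indicator, h1, h2]
    have T := as_tele2 (fun i j => f (X i) (Y j)) _ _ n hk hl
    simp only [X0, Y0, ex, ey] at T
    simp only [T, hS1, hS2, hS3, GG, hx.1, hy.1, if_true, add_mul, Finset.sum_mul, one_mul, mul_one,
      mul_assoc]
  have i0 : Integrable (fun z => f a c * G a c z) (volume.restrict (Set.Ioc a b ×ˢ Set.Ioc c d)) :=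
    (Gi a c).const_mul _
  have i1 : Integrable S1 (volume.restrict (Set.Ioc a b ×ˢ Set.Ioc c d)) :=
    integrable_finsetSum _ fun i _ => (Gi _ _).const_mul _
  have i2 : Integrable S2 (volume.restrict (Set.Ioc a b ×ˢ Set.Ioc c d)) :=
    integrable_finsetSum _ fun i _ => (Gi _ _).const_mul _
  have i3 : Integrable S3 (volume.restrict (Set.Ioc a b ×ˢ Set.Ioc c d)) :=
    integrable_finsetSum _ fun i _ => integrable_finsetSum _ fun j _ => (Gi _ _).const_mul _
  have ca : a ∈ Set.Icc a b := ⟨le_rfl, hab.le⟩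
  have cc : c ∈ Set.Icc c d := ⟨le_rfl, hcd.le⟩
  have p1 : 0 ≤ ∫ z in Set.Ioc a b ×ˢ Set.Ioc c d, S1 z := by
    rw [integral_finsetSum _ fun i _ => (Gi _ _).const_mul _]
    refine Finset.sum_nonneg fun i hi => ?_
    have hi := Finset.mem_range.1 hi
    rw [MeasureTheory.integral_const_mul, Gv _ (Xm _ hi) _ cc]
    exact mul_nonneg (sub_nonneg.2 (hf_inc_x c cc (Xm _ hi.le) (Xm _ hi) (Xs i))) (hW _ (Xm _ hi) _ cc)
  have p2 : 0 ≤ ∫ z in Set.Ioc a b ×ˢ Set.Ioc c d, S2 z := by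
    rw [integral_finsetSum _ fun i _ => (Gi _ _).const_mul _]
    refine Finset.sum_nonneg fun i hi => ?_
    have hi := Finset.mem_range.1 hi
    rw [MeasureTheory.integral_const_mul, Gv _ ca _ (Ym _ hi)]
    exact mul_nonneg (sub_nonneg.2 (hf_inc_y a ca (Ym _ hi.le) (Ym _ hi) (Ys i))) (hW _ ca _ (Ym _ hi))
  have p3 : 0 ≤ ∫ z in Set.Ioc a b ×ˢ Set.Ioc c d, S3 z := by
    rw [integral_finsetSum _ fun i _ => integrable_finsetSum _ fun j _ => (Gi _ _).const_mul _]
    refine Finset.sum_nonneg fun i hi => ?_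
    rw [integral_finsetSum _ fun i _ => (Gi _ _).const_mul _]
    refine Finset.sum_nonneg fun j hj => ?_
    have hi := Finset.mem_range.1 hi
    have hj := Finset.mem_range.1 hj
    rw [MeasureTheory.integral_const_mul, Gv _ (Xm _ hi) _ (Ym _ hj)]
    exact mul_nonneg (hf2d _ (Xm _ hi.le) _ (Xm _ hi) _ (Ym _ hj.le) _ (Ym _ hj) (Xs i) (Ys j))
      (hW _ (Xm _ hi) _ (Ym _ hj))
  constructor
  · exact IntegrableOn.congr_fun (((i0.add i1).add i2).add i3) E.symm mR
  · have e1 := setIntegral_congr_fun (μ := volume) mR E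
    have e2 : ∫ z in Set.Ioc a b ×ˢ Set.Ioc c d, (f a c * G a c z + S1 z + S2 z + S3 z)
      = f a c * (∫ s in a..b, ∫ t in c..d, w s t) + (∫ z in Set.Ioc a b ×ˢ Set.Ioc c d, S1 z)
        + (∫ z in Set.Ioc a b ×ˢ Set.Ioc c d, S2 z) + ∫ z in Set.Ioc a b ×ˢ Set.Ioc c d, S3 z := by
      have j1 : Integrable (fun z => f a c * G a c z + S1 z)
        (volume.restrict (Set.Ioc a b ×ˢ Set.Ioc c d)) := i0.add i1
      have j2 : Integrable (fun z => f a c * G a c z + S1 z + S2 z)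
        (volume.restrict (Set.Ioc a b ×ˢ Set.Ioc c d)) := j1.add i2
      rw [MeasureTheory.integral_add j2 i3, MeasureTheory.integral_add j1 i2,
        MeasureTheory.integral_add i0 i1,
        MeasureTheory.integral_const_mul, Gv a ca c cc]
    change _ ≤ ∫ z in Set.Ioc a b ×ˢ Set.Ioc c d, f (X (asK a h z.1)) (Y (asK c g z.2)) * w z.1 z.2
    rw [e1, e2]; linarith

lemma as_phi_tendsto (a b x : ℝ) (hab : a < b) (hx : a < x) :
    Filter.Tendsto (fun n : ℕ => a + asK a ((b-a)/(n+1 : ℕ)) x * ((b-a)/(n+1 : ℕ)))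
      Filter.atTop (nhds x) := by
  have h0 : Filter.Tendsto (fun n : ℕ => (b-a)/((n+1 : ℕ) : ℝ)) Filter.atTop (nhds 0) :=
    (tendsto_const_div_atTop_nhds_zero_nat (b-a)).comp (Filter.tendsto_add_atTop_nat 1)
  have h1 : Filter.Tendsto (fun n : ℕ => x - (b-a)/((n+1 : ℕ) : ℝ)) Filter.atTop (nhds x) := by
    simpa using h0.const_sub x
  have hp : ∀ n : ℕ, 0 < (b-a)/((n+1 : ℕ) : ℝ) := fun n => div_pos (by linarith) (by positivity)
  exact tendsto_of_tendsto_of_tendsto_of_le_of_le h1 tendsto_const_nhds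
    (fun n => (as_K_bd a _ x (hp n) hx).1) (fun n => (as_K_bd a _ x (hp n) hx).2)

lemma as_phi_mem (a b x : ℝ) (hab : a < b) (hx : x ∈ Set.Ioc a b) (n : ℕ) :
    a + asK a ((b-a)/(n+1 : ℕ)) x * ((b-a)/(n+1 : ℕ)) ∈ Set.Icc a b := by
  have hp : 0 < (b-a)/((n+1 : ℕ) : ℝ) := div_pos (by linarith) (by positivity)
  have := (as_K_bd a _ x hp hx.1).2
  refine ⟨?_, this.trans hx.2⟩
  have : 0 ≤ (asK a ((b-a)/(n+1 : ℕ)) x : ℝ) * ((b-a)/(n+1 : ℕ)) := by positivity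
  linarith

/-- Companion Abel–Steffensen inequality (Theorem 4 of the paper):
if `f` is nonnegative, continuously differentiable and 2d-monotone increasing on
`[a,b] × [c,d]`, `w` is integrable and `W̃ x y = ∫_x^b ∫_y^d w(s,t) dt ds ≥ 0`, then
`∫_a^b ∫_c^d f w ≥ f(a,c) W̃(a,c)`. -/
theorem abel_steffensen_integral_increasing
    (a b c d : ℝ) (hab : a ≤ b) (hcd : c ≤ d)
    (f w : ℝ → ℝ → ℝ)
    (hf_nonneg : ∀ x ∈ Set.Icc a b, ∀ y ∈ Set.Icc c d, 0 ≤ f x y)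
    (hf : ContDiffOn ℝ 1 (fun p : ℝ × ℝ => f p.1 p.2) (Set.Icc a b ×ˢ Set.Icc c d))
    (hf2d : ∀ a' ∈ Set.Icc a b, ∀ b' ∈ Set.Icc a b, ∀ c' ∈ Set.Icc c d, ∀ d' ∈ Set.Icc c d,
      a' ≤ b' → c' ≤ d' → 0 ≤ f a' c' - f a' d' - f b' c' + f b' d')
    (hf_inc_x : ∀ y ∈ Set.Icc c d, MonotoneOn (fun x => f x y) (Set.Icc a b))
    (hf_inc_y : ∀ x ∈ Set.Icc a b, MonotoneOn (fun y => f x y) (Set.Icc c d))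
    (hw : IntegrableOn (fun p : ℝ × ℝ => w p.1 p.2) (Set.Icc a b ×ˢ Set.Icc c d))
    (hW : ∀ x ∈ Set.Icc a b, ∀ y ∈ Set.Icc c d, 0 ≤ ∫ s in x..b, ∫ t in y..d, w s t) :
    f a c * (∫ s in a..b, ∫ t in c..d, w s t) ≤
      ∫ x in a..b, ∫ y in c..d, f x y * w x y := by
  rcases hab.eq_or_lt with rfl | hab'
  · simp
  rcases hcd.eq_or_lt with rfl | hcd'
  · simp
  have hsub : Set.Ioc a b ×ˢ Set.Ioc c d ⊆ Set.Icc a b ×ˢ Set.Icc c d :=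
    Set.prod_mono Set.Ioc_subset_Icc_self Set.Ioc_subset_Icc_self
  have hw' := hw.mono_set hsub
  have mR : MeasurableSet (Set.Ioc a b ×ˢ Set.Ioc c d) := measurableSet_Ioc.prod measurableSet_Ioc
  have hfc := hf.continuousOn
  have cb : b ∈ Set.Icc a b := ⟨hab, le_rfl⟩
  have cd' : d ∈ Set.Icc c d := ⟨hcd, le_rfl⟩
  have bound : ∀ x ∈ Set.Icc a b, ∀ y ∈ Set.Icc c d, ‖f x y‖ ≤ f b d := by
    intro x hx y hy
    rw [Real.norm_eq_abs, abs_of_nonneg (hf_nonneg x hx y hy)]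
    exact (hf_inc_x y hy hx cb hx.2).trans (hf_inc_y b cb hy cd' hy.2)
  have St := fun n : ℕ => as_step a b c d hab' hcd' f w hf2d hf_inc_x hf_inc_y hw' hW (n+1) (by omega)
  have lim : Filter.Tendsto (fun n : ℕ => ∫ z in Set.Ioc a b ×ˢ Set.Ioc c d,
      f (a + asK a ((b-a)/(n+1 : ℕ)) z.1 * ((b-a)/(n+1 : ℕ)))
        (c + asK c ((d-c)/(n+1 : ℕ)) z.2 * ((d-c)/(n+1 : ℕ))) * w z.1 z.2) Filter.atTop
      (nhds (∫ z in Set.Ioc a b ×ˢ Set.Ioc c d, f z.1 z.2 * w z.1 z.2)) := by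
    refine tendsto_integral_of_dominated_convergence (fun z => f b d * ‖w z.1 z.2‖)
      (fun n => (St n).1.aestronglyMeasurable) (hw'.norm.const_mul _) (fun n => ?_) ?_
    · refine (ae_restrict_iff' mR).2 (Filter.Eventually.of_forall fun z hz => ?_)
      rw [norm_mul]
      exact mul_le_mul_of_nonneg_right
        (bound _ (as_phi_mem a b z.1 hab' hz.1 n) _ (as_phi_mem c d z.2 hcd' hz.2 n)) (norm_nonneg _)
    · refine (ae_restrict_iff' mR).2 (Filter.Eventually.of_forall fun z hz => ?_)
      refine Filter.Tendsto.mul_const _ ?_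
      have h1 := hfc z (hsub hz)
      refine Filter.Tendsto.comp (f := fun n : ℕ => ((a + asK a ((b-a)/(n+1 : ℕ)) z.1 * ((b-a)/(n+1 : ℕ)),
        c + asK c ((d-c)/(n+1 : ℕ)) z.2 * ((d-c)/(n+1 : ℕ))) : ℝ × ℝ)) h1 ?_
      refine tendsto_nhdsWithin_iff.2 ⟨?_, Filter.Eventually.of_forall fun n =>
        ⟨as_phi_mem a b z.1 hab' hz.1 n, as_phi_mem c d z.2 hcd' hz.2 n⟩⟩
      exact (as_phi_tendsto a b z.1 hab' hz.1.1).prodMk_nhds (as_phi_tendsto c d z.2 hcd' hz.2.1)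
  have key := ge_of_tendsto' lim fun n => (St n).2
  refine key.trans_eq ?_
  rw [Measure.volume_eq_prod, setIntegral_prod, integral_of_le hab]
  · simp only [integral_of_le hcd]
  · refine Integrable.bdd_mul (c := f b d) hw' ((hfc.mono hsub).aestronglyMeasurable mR) ?_
    exact (ae_restrict_iff' mR).2 (Filter.Eventually.of_forall fun z hz =>
      bound _ (hsub hz).1 _ (hsub hz).2)
end

section
/- Let f and w be real-valued functions on [a,b] × [c,d] such that: (i) f is continuously differentiable, 2d-alternating, and its partial derivatives satisfy (∂f/∂x)(x,d) ≥ 0 for all x ∈ [a,b] and (∂f/∂y)(b,y) ≥ 0 for all y ∈ [c,d]; (ii) w is integrable and W(x,y) = ∫_a^x ∫_c^y w(s,t) dt ds ≤ 0 for all (x,y) ∈ [a,b] × [c,d]. Then ∫_a^b ∫_c^d f(x,y) w(x,y) dy dx ≥ f(b,d) W(b,d). -/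
open intervalIntegral MeasureTheory

lemma aux_tel (u : ℕ → ℝ) (k m : ℕ) :
    ∑ i ∈ Finset.range m, (if k ≤ i then u i - u (i+1) else 0)
      = if k ≤ m then u k - u m else 0 := by
  induction m with
  | zero =>
    by_cases h : k ≤ 0
    · have : k = 0 := by omega
      simp [this]
    · simp [h]
  | succ m ih =>
    rw [Finset.sum_range_succ, ih]
    by_cases h : k ≤ m
    · have h' : k ≤ m + 1 := by omega
      simp [h, h']
    · by_cases h' : k ≤ m + 1
      · have : k = m + 1 := by omega
        simp [this]
      · simp [h, h']

lemma aux_tel2 (H : ℕ → ℕ → ℝ) (k l m : ℕ) (hk : k ≤ m) (hl : l ≤ m)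
    (h1 : ∀ i, H i m = 0) (h2 : ∀ j, H m j = 0) :
    ∑ i ∈ Finset.range m, ∑ j ∈ Finset.range m,
      (if k ≤ i ∧ l ≤ j then (H i j - H (i+1) j - H i (j+1) + H (i+1) (j+1)) else 0)
      = H k l := by
  have inner : ∀ i, ∑ j ∈ Finset.range m,
      (if k ≤ i ∧ l ≤ j then (H i j - H (i+1) j - H i (j+1) + H (i+1) (j+1)) else 0)
      = if k ≤ i then H i l - H (i+1) l else 0 := by
    intro i
    by_cases hi : k ≤ i
    · have := aux_tel (fun j => H i j - H (i+1) j) l m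
      simp only [hl, if_true, h1] at this
      simp only [hi, true_and, if_true]
      rw [sub_zero, sub_zero] at this
      rw [← this]
      refine Finset.sum_congr rfl fun j _ => ?_
      split_ifs
      · ring
      · rfl
    · simp [hi]
  simp only [inner]
  have := aux_tel (fun i => H i l) k m
  simp only [hk, if_true, h2, sub_zero] at this
  exact this

noncomputable def auxGrid (a b : ℝ) (N i : ℕ) : ℝ := a + i * ((b - a) / N)

lemma auxGrid_mem (a b : ℝ) (hab : a ≤ b) (N i : ℕ) (hN : 0 < N) (hi : i ≤ N) :
    auxGrid a b N i ∈ Set.Icc a b := by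
  have hN' : (0:ℝ) < N := by exact_mod_cast hN
  have hi' : (i:ℝ) ≤ N := by exact_mod_cast hi
  have h0 : 0 ≤ (b - a) / N := div_nonneg (by linarith) hN'.le
  unfold auxGrid
  constructor
  · have : 0 ≤ (i:ℝ) * ((b - a) / N) := by positivity
    linarith
  · have : (i:ℝ) * ((b - a) / N) ≤ N * ((b - a) / N) := by gcongr
    have h2 : (N:ℝ) * ((b - a) / N) = b - a := by field_simp
    linarith

lemma auxGrid_mono (a b : ℝ) (hab : a ≤ b) (N i : ℕ) :
    auxGrid a b N i ≤ auxGrid a b N (i+1) := by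
  have h0 : 0 ≤ (b - a) / N := div_nonneg (by linarith) (by positivity)
  unfold auxGrid
  push_cast
  nlinarith

lemma auxGrid_last (a b : ℝ) (N : ℕ) (hN : 0 < N) : auxGrid a b N N = b := by
  have hN' : (0:ℝ) < N := by exact_mod_cast hN
  unfold auxGrid
  field_simp
  ring

lemma auxGrid_ceil (a b x : ℝ) (hx : x ∈ Set.Ioc a b) (N : ℕ) (hN : 0 < N) :
    ∃ k : ℕ, k ≤ N ∧ (∀ i : ℕ, x ≤ auxGrid a b N i ↔ k ≤ i) ∧
      x ≤ auxGrid a b N k ∧ auxGrid a b N k ≤ x + (b - a) / N := by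
  have hN' : (0:ℝ) < N := by exact_mod_cast hN
  obtain ⟨h1, h2⟩ := hx
  have hδ : 0 < (b - a) / N := div_pos (by linarith) hN'
  have key : ∀ i : ℕ, x ≤ auxGrid a b N i ↔ ⌈(x - a) / ((b - a) / N)⌉₊ ≤ i := by
    intro i
    rw [Nat.ceil_le, div_le_iff₀ hδ]
    unfold auxGrid
    constructor <;> intro h <;> linarith
  refine ⟨⌈(x - a) / ((b - a) / N)⌉₊, ?_, key, (key _).2 le_rfl, ?_⟩
  · rw [← key, auxGrid_last a b N hN]; exact h2
  · have h3 : (⌈(x - a) / ((b - a) / N)⌉₊ : ℝ) < (x - a) / ((b - a) / N) + 1 :=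
      Nat.ceil_lt_add_one (div_nonneg (by linarith) hδ.le)
    unfold auxGrid
    have h4 := mul_lt_mul_of_pos_right h3 hδ
    rw [add_mul, div_mul_cancel₀ _ hδ.ne'] at h4
    linarith

lemma aux_main (a b c d : ℝ) (hab : a ≤ b) (hcd : c ≤ d) (G : ℝ → ℝ → ℝ) (w : ℝ × ℝ → ℝ)
    (hG : ContinuousOn (fun p : ℝ × ℝ => G p.1 p.2) (Set.Icc a b ×ˢ Set.Icc c d))
    (hm : ∀ a' ∈ Set.Icc a b, ∀ b' ∈ Set.Icc a b, ∀ c' ∈ Set.Icc c d, ∀ d' ∈ Set.Icc c d,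
      a' ≤ b' → c' ≤ d' → 0 ≤ G a' c' - G a' d' - G b' c' + G b' d')
    (hx : AntitoneOn (fun x => G x d) (Set.Icc a b))
    (hy : AntitoneOn (fun y => G b y) (Set.Icc c d))
    (h0 : 0 ≤ G b d)
    (hw : IntegrableOn w (Set.Ioc a b ×ˢ Set.Ioc c d))
    (hW : ∀ x ∈ Set.Icc a b, ∀ y ∈ Set.Icc c d, (∫ p in Set.Ioc a x ×ˢ Set.Ioc c y, w p) ≤ 0) :
    ∫ p in Set.Ioc a b ×ˢ Set.Ioc c d, G p.1 p.2 * w p ≤ 0 := by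
  set R := Set.Ioc a b ×ˢ Set.Ioc c d with hR
  have hRm : MeasurableSet R := measurableSet_Ioc.prod measurableSet_Ioc
  obtain ⟨M, hM⟩ := (isCompact_Icc.prod isCompact_Icc).exists_bound_of_continuousOn hG
  let H : ℕ → ℕ → ℕ → ℝ := fun n i j =>
    if i ≤ n + 1 ∧ j ≤ n + 1 then G (auxGrid a b (n+1) i) (auxGrid c d (n+1) j) else 0
  let μ : ℕ → ℕ → ℕ → ℝ := fun n i j =>
    H n i j - H n (i+1) j - H n i (j+1) + H n (i+1) (j+1)
  let A : ℕ → ℕ → ℕ → Set (ℝ × ℝ) := fun n i j =>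
    Set.Ioc a (auxGrid a b (n+1) i) ×ˢ Set.Ioc c (auxGrid c d (n+1) j)
  have hA : ∀ n i j, MeasurableSet (A n i j) := fun n i j =>
    measurableSet_Ioc.prod measurableSet_Ioc
  have hμ : ∀ n i j, i ≤ n + 1 → j ≤ n + 1 → 0 ≤ μ n i j := by
    intro n i j hi hj
    have gi := auxGrid_mem a b hab (n+1) i n.succ_pos hi
    have gj := auxGrid_mem c d hcd (n+1) j n.succ_pos hj
    have mi := auxGrid_mono a b hab (n+1) i
    have mj := auxGrid_mono c d hcd (n+1) j
    have li := auxGrid_last a b (n+1) n.succ_pos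
    have lj := auxGrid_last c d (n+1) n.succ_pos
    simp only [μ, H]
    by_cases hi' : i + 1 ≤ n + 1
    · have gi' := auxGrid_mem a b hab (n+1) (i+1) n.succ_pos hi'
      by_cases hj' : j + 1 ≤ n + 1
      · have gj' := auxGrid_mem c d hcd (n+1) (j+1) n.succ_pos hj'
        simp only [hi, hj, hi', hj', and_self, if_true]
        have := hm _ gi _ gi' _ gj _ gj' mi mj
        linarith
      · have ej : j = n + 1 := by omega
        simp only [hi, hj, hi', hj', and_self, if_true, and_false, if_false]
        subst ej
        rw [lj]
        have := hx gi gi' mi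
        simp only at this
        linarith
    · have ei : i = n + 1 := by omega
      by_cases hj' : j + 1 ≤ n + 1
      · have gj' := auxGrid_mem c d hcd (n+1) (j+1) n.succ_pos hj'
        simp only [hi, hj, hi', hj', and_self, if_true, false_and, if_false]
        subst ei
        rw [li]
        have := hy gj gj' mj
        simp only at this
        linarith
      · have ej : j = n + 1 := by omega
        simp only [hi, hj, hi', hj', and_self, if_true, and_false, false_and, if_false]
        subst ei
        rw [li, ej, lj]
        linarith
  let F : ℕ → ℝ × ℝ → ℝ := fun n p =>
    ∑ i ∈ Finset.range (n+2), ∑ j ∈ Finset.range (n+2), μ n i j * (A n i j).indicator w p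
  have hint : ∀ n i j, Integrable (fun p => μ n i j * (A n i j).indicator w p)
      (volume.restrict R) := fun n i j =>
    (Integrable.indicator hw (hA n i j)).const_mul _
  have hFint : ∀ n, Integrable (F n) (volume.restrict R) := fun n =>
    integrable_finsetSum _ fun i _ => integrable_finsetSum _ fun j _ => hint n i j
  have hFle : ∀ n, ∫ p in R, F n p ≤ 0 := by
    intro n
    simp only [F]
    rw [integral_finsetSum _ fun i _ => integrable_finsetSum _ fun j _ => hint n i j]
    refine Finset.sum_nonpos fun i hi => ?_
    rw [integral_finsetSum _ fun j _ => hint n i j]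
    refine Finset.sum_nonpos fun j hj => ?_
    have hi' : i ≤ n + 1 := by have := Finset.mem_range.1 hi; omega
    have hj' : j ≤ n + 1 := by have := Finset.mem_range.1 hj; omega
    have gi := auxGrid_mem a b hab (n+1) i n.succ_pos hi'
    have gj := auxGrid_mem c d hcd (n+1) j n.succ_pos hj'
    rw [MeasureTheory.integral_const_mul, setIntegral_indicator (hA n i j)]
    have : R ∩ A n i j = A n i j := by
      apply Set.inter_eq_right.2
      exact Set.prod_mono (Set.Ioc_subset_Ioc_right gi.2) (Set.Ioc_subset_Ioc_right gj.2)
    rw [this]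
    exact mul_nonpos_of_nonneg_of_nonpos (hμ n i j hi' hj') (hW _ gi _ gj)
  have hFval : ∀ p ∈ R, ∀ n, ∃ q ∈ Set.Icc a b ×ˢ Set.Icc c d, F n p = G q.1 q.2 * w p ∧
      p.1 ≤ q.1 ∧ q.1 ≤ p.1 + (b - a) / (n+1:ℕ) ∧ p.2 ≤ q.2 ∧ q.2 ≤ p.2 + (d - c) / (n+1:ℕ) := by
    intro p hp n
    obtain ⟨k, hk, hk1, hk2, hk3⟩ := auxGrid_ceil a b p.1 hp.1 (n+1) n.succ_pos
    obtain ⟨l, hl, hl1, hl2, hl3⟩ := auxGrid_ceil c d p.2 hp.2 (n+1) n.succ_pos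
    refine ⟨(auxGrid a b (n+1) k, auxGrid c d (n+1) l),
      ⟨auxGrid_mem a b hab _ _ n.succ_pos hk, auxGrid_mem c d hcd _ _ n.succ_pos hl⟩, ?_,
      hk2, hk3, hl2, hl3⟩
    have ht := aux_tel2 (H n) k l (n+2) (by omega) (by omega) (by intro i; simp [H])
      (by intro i; simp [H])
    have hH : H n k l = G (auxGrid a b (n+1) k) (auxGrid c d (n+1) l) := by simp [H, hk, hl]
    rw [hH] at ht
    simp only [F]
    rw [← ht, Finset.sum_mul]
    refine Finset.sum_congr rfl fun i _ => ?_
    rw [Finset.sum_mul]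
    refine Finset.sum_congr rfl fun j _ => ?_
    have hmem : p ∈ A n i j ↔ k ≤ i ∧ l ≤ j := by
      rw [← hk1, ← hl1]
      simp only [A, Set.mem_prod, Set.mem_Ioc]
      have := hp.1.1
      have := hp.2.1
      tauto
    by_cases h : k ≤ i ∧ l ≤ j
    · rw [Set.indicator_of_mem (hmem.2 h), if_pos h]
    · rw [Set.indicator_of_notMem (fun h' => h (hmem.1 h')), if_neg h]
      ring
  have hlim : Filter.Tendsto (fun n => ∫ p in R, F n p) Filter.atTop
      (nhds (∫ p in R, G p.1 p.2 * w p)) := by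
    refine tendsto_integral_of_dominated_convergence (fun p => M * ‖w p‖)
      (fun n => (hFint n).aestronglyMeasurable) (hw.norm.const_mul M) ?_ ?_
    · intro n
      filter_upwards [ae_restrict_mem hRm] with p hp
      obtain ⟨q, hq, e, -⟩ := hFval p hp n
      rw [e, norm_mul]
      exact mul_le_mul_of_nonneg_right (hM q hq) (norm_nonneg _)
    · filter_upwards [ae_restrict_mem hRm] with p hp
      choose q hq e h1 h2 h3 h4 using hFval p hp
      simp only [e]
      refine Filter.Tendsto.mul_const _ ?_
      have hp' : p ∈ Set.Icc a b ×ˢ Set.Icc c d :=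
        ⟨Set.Ioc_subset_Icc_self hp.1, Set.Ioc_subset_Icc_self hp.2⟩
      have hz : ∀ x C : ℝ, Filter.Tendsto (fun n : ℕ => x + C / ((n+1:ℕ):ℝ)) Filter.atTop
          (nhds x) := by
        intro x C
        have := ((tendsto_const_div_atTop_nhds_zero_nat C).comp
          (Filter.tendsto_add_atTop_nat 1)).const_add x
        simpa using this
      have hq' : Filter.Tendsto q Filter.atTop (nhds p) := by
        rw [Prod.tendsto_iff]
        exact ⟨tendsto_of_tendsto_of_tendsto_of_le_of_le tendsto_const_nhds (hz _ _) h1 h2,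
          tendsto_of_tendsto_of_tendsto_of_le_of_le tendsto_const_nhds (hz _ _) h3 h4⟩
      exact (hG p hp').tendsto.comp
        (tendsto_nhdsWithin_iff.2 ⟨hq', Filter.Eventually.of_forall hq⟩)
  exact le_of_tendsto' hlim hFle

lemma aux_prod (a b c d x y : ℝ) (hx : x ∈ Set.Icc a b) (hy : y ∈ Set.Icc c d)
    (v : ℝ → ℝ → ℝ)
    (hv : IntegrableOn (fun p : ℝ × ℝ => v p.1 p.2) (Set.Ioc a b ×ˢ Set.Ioc c d)) :
    ∫ p in Set.Ioc a x ×ˢ Set.Ioc c y, v p.1 p.2 = ∫ s in a..x, ∫ t in c..y, v s t := by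
  have h : IntegrableOn (fun p : ℝ × ℝ => v p.1 p.2) (Set.Ioc a x ×ˢ Set.Ioc c y) :=
    hv.mono_set (Set.prod_mono (Set.Ioc_subset_Ioc_right hx.2) (Set.Ioc_subset_Ioc_right hy.2))
  rw [integral_of_le hx.1]
  simp only [integral_of_le hy.1]
  rw [Measure.volume_eq_prod] at h ⊢
  exact setIntegral_prod _ h

/-- Remark 3 of the paper: if `f` is continuously differentiable, 2d-alternating, with
`(∂f/∂x)(x,d) ≥ 0` and `(∂f/∂y)(b,y) ≥ 0`, and `w` is integrable with
`W x y = ∫_a^x ∫_c^y w(s,t) dt ds ≤ 0` on `[a,b] × [c,d]`, then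
`∫_a^b ∫_c^d f w ≥ f(b,d) W(b,d)`. -/
theorem abel_steffensen_integral_alternating
    (a b c d : ℝ) (hab : a ≤ b) (hcd : c ≤ d)
    (f w : ℝ → ℝ → ℝ) (fx fy : ℝ → ℝ)
    (hf : ContDiffOn ℝ 1 (fun p : ℝ × ℝ => f p.1 p.2) (Set.Icc a b ×ˢ Set.Icc c d))
    (hf2d_alt : ∀ a' ∈ Set.Icc a b, ∀ b' ∈ Set.Icc a b, ∀ c' ∈ Set.Icc c d, ∀ d' ∈ Set.Icc c d,
      a' ≤ b' → c' ≤ d' → f a' c' - f a' d' - f b' c' + f b' d' ≤ 0)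
    (hfx : ∀ x ∈ Set.Icc a b, HasDerivAt (fun x' => f x' d) (fx x) x)
    (hfx_nonneg : ∀ x ∈ Set.Icc a b, 0 ≤ fx x)
    (hfy : ∀ y ∈ Set.Icc c d, HasDerivAt (fun y' => f b y') (fy y) y)
    (hfy_nonneg : ∀ y ∈ Set.Icc c d, 0 ≤ fy y)
    (hw : IntegrableOn (fun p : ℝ × ℝ => w p.1 p.2) (Set.Icc a b ×ˢ Set.Icc c d))
    (hW : ∀ x ∈ Set.Icc a b, ∀ y ∈ Set.Icc c d, (∫ s in a..x, ∫ t in c..y, w s t) ≤ 0) :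
    f b d * (∫ s in a..b, ∫ t in c..d, w s t) ≤
      ∫ x in a..b, ∫ y in c..d, f x y * w x y := by
  have hsub : Set.Ioc a b ×ˢ Set.Ioc c d ⊆ Set.Icc a b ×ˢ Set.Icc c d :=
    Set.prod_mono Set.Ioc_subset_Icc_self Set.Ioc_subset_Icc_self
  have hb : b ∈ Set.Icc a b := ⟨hab, le_rfl⟩
  have hd : d ∈ Set.Icc c d := ⟨hcd, le_rfl⟩
  have hw' := hw.mono_set hsub
  have hfw : IntegrableOn (fun p : ℝ × ℝ => f p.1 p.2 * w p.1 p.2)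
      (Set.Ioc a b ×ˢ Set.Ioc c d) :=
    (hw.continuousOn_mul hf.continuousOn (isCompact_Icc.prod isCompact_Icc)).mono_set hsub
  have hmx : MonotoneOn (fun x => f x d) (Set.Icc a b) :=
    monotoneOn_of_hasDerivWithinAt_nonneg (convex_Icc a b)
      (fun x hx => (hfx x hx).continuousAt.continuousWithinAt)
      (fun x hx => (hfx x (interior_subset hx)).hasDerivWithinAt)
      (fun x hx => hfx_nonneg x (interior_subset hx))
  have hmy : MonotoneOn (fun y => f b y) (Set.Icc c d) :=
    monotoneOn_of_hasDerivWithinAt_nonneg (convex_Icc c d)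
      (fun x hx => (hfy x hx).continuousAt.continuousWithinAt)
      (fun x hx => (hfy x (interior_subset hx)).hasDerivWithinAt)
      (fun x hx => hfy_nonneg x (interior_subset hx))
  have key := aux_main a b c d hab hcd (fun x y => f b d - f x y) (fun p => w p.1 p.2)
    (continuousOn_const.sub hf.continuousOn)
    (fun a' ha' b' hb' c' hc' d' hd' h1 h2 => by
      have := hf2d_alt a' ha' b' hb' c' hc' d' hd' h1 h2
      linarith)
    (fun x hx y hy h => sub_le_sub_left (hmx hx hy h) _)
    (fun x hx y hy h => sub_le_sub_left (hmy hx hy h) _)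
    (by simp) hw'
    (fun x hx y hy => by
      rw [aux_prod a b c d x y hx hy w hw']
      exact hW x hx y hy)
  simp only [sub_mul] at key
  rw [integral_sub (hw'.const_mul _) hfw, MeasureTheory.integral_const_mul, aux_prod a b c d b d hb hd w hw',
    aux_prod a b c d b d hb hd (fun x y => f x y * w x y) hfw] at key
  linarith
end

section
/- For every function f : [0, 4π] → ℝ that is monotone (either increasing or decreasing) and convex on [0, 4π], and for all positive integers m and n, one has ∫_0^{2π} ∫_0^{2π} f(s + t) sin(ms) sin(nt) ds dt ≥ 0. -/
open intervalIntegral Real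

namespace SineAux
open MeasureTheory Filter Topology

noncomputable def cl (x : ℝ) : ℝ := max 0 (min x (2 * π))

noncomputable def R (m : ℕ) (x : ℝ) : ℝ := (1 - Real.cos (m * cl x)) / m

noncomputable def S (m : ℕ) (x : ℝ) : ℝ := (Set.Ioc 0 (2 * π)).indicator (fun x => Real.sin (m * x)) x

lemma cl_lip (x y : ℝ) : |cl x - cl y| ≤ |x - y| := by
  unfold cl
  calc _ ≤ |min x (2*π) - min y (2*π)| := by
        simpa using abs_max_sub_max_le_max 0 (min x (2*π)) 0 (min y (2*π))
    _ ≤ _ := by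
        simpa using abs_min_sub_min_le_max x (2*π) y (2*π)

lemma R_nonneg (m : ℕ) (x : ℝ) : 0 ≤ R m x := by
  unfold R
  have := Real.cos_le_one (m * cl x)
  exact div_nonneg (by linarith) (by positivity)

lemma R_lip (m : ℕ) (hm : 0 < m) (x y : ℝ) : |R m x - R m y| ≤ |x - y| := by
  refine le_trans ?_ (cl_lip x y)
  have hm' : (0:ℝ) < m := by exact_mod_cast hm
  have h1 : R m x - R m y = (Real.cos (m * cl y) - Real.cos (m * cl x)) / m := by
    unfold R; ring
  have h2 : |Real.cos (m * cl y) - Real.cos (m * cl x)| ≤ |m * cl y - m * cl x| := by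
    have := Real.lipschitzWith_cos.dist_le_mul (m * cl y) (m * cl x)
    simpa [Real.dist_eq] using this
  rw [h1, abs_div, abs_of_pos hm', div_le_iff₀ hm']
  refine h2.trans ?_
  rw [← mul_sub, abs_mul, abs_of_pos hm', abs_sub_comm (cl y), mul_comm]

lemma R_left (m : ℕ) (x : ℝ) (hx : x ≤ 0) : R m x = 0 := by
  have : cl x = 0 := by
    unfold cl
    exact max_eq_left ((min_le_left _ _).trans hx)
  simp [R, this]

lemma R_right (m : ℕ) (x : ℝ) (hx : 2 * π ≤ x) : R m x = 0 := by
  have : cl x = 2 * π := by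
    unfold cl
    rw [min_eq_right hx, max_eq_right (by positivity)]
  simp [R, this, Real.cos_nat_mul_two_pi]

lemma R_mid (m : ℕ) (x : ℝ) (h0 : 0 ≤ x) (hx : x ≤ 2 * π) :
    R m x = (1 - Real.cos (m * x)) / m := by
  have : cl x = x := by
    unfold cl
    rw [min_eq_left hx, max_eq_right h0]
  simp [R, this]

lemma R_cont (m : ℕ) : Continuous (R m) := by
  unfold R cl
  fun_prop

lemma quot_tendsto (m : ℕ) (hm : 0 < m) (s : ℝ) :
    Tendsto (fun h : ℝ => (R m s - R m (s - h)) / h) (𝓝[>] 0) (𝓝 (S m s)) := by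
  have hm' : (m:ℝ) ≠ 0 := by exact_mod_cast hm.ne'
  rcases le_or_gt s 0 with hs | hs
  · have : S m s = 0 := by
      unfold S; rw [Set.indicator_of_notMem]; simp; intro h; linarith
    rw [this]
    refine tendsto_const_nhds.congr' ?_
    filter_upwards [self_mem_nhdsWithin] with h hh
    have hh : 0 < h := hh
    rw [R_left m s hs, R_left m (s-h) (by linarith)]; simp
  rcases le_or_gt s (2 * π) with hs2 | hs2
  · have h1 : S m s = Real.sin (m * s) := by
      unfold S; rw [Set.indicator_of_mem]; exact ⟨hs, hs2⟩
    have hd : HasDerivAt (fun h : ℝ => -((1 - Real.cos (m * (s - h))) / m)) (Real.sin (m * s)) 0 := by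
      have a : HasDerivAt (fun h : ℝ => (m:ℝ) * (s - h)) (m * (-1)) 0 :=
        ((hasDerivAt_id (0:ℝ)).const_sub s).const_mul (m:ℝ)
      have := (((a.cos).const_sub 1).div_const (m:ℝ)).neg
      have e : -(-(-Real.sin (m * (s - 0)) * (m * -1)) / (m:ℝ)) = Real.sin (m * s) := by
        rw [sub_zero]; field_simp
      rw [e] at this
      exact this
    rw [hasDerivAt_iff_tendsto_slope] at hd
    have hd2 := hd.mono_left (nhdsWithin_mono (0:ℝ) (s := Set.Ioi 0) (fun x hx => (ne_of_gt hx : x ≠ 0)))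
    rw [h1]
    refine hd2.congr' ?_
    filter_upwards [Ioo_mem_nhdsGT hs] with h hh
    rw [R_mid m s hs.le hs2, R_mid m (s-h) (by linarith [hh.2]) (by linarith [hh.1])]
    simp [slope_def_field]
    ring
  · have : S m s = 0 := by
      unfold S; rw [Set.indicator_of_notMem]; simp; intro h; linarith
    rw [this]
    refine tendsto_const_nhds.congr' ?_
    filter_upwards [Ioo_mem_nhdsGT (sub_pos.2 hs2)] with h hh
    rw [R_right m s hs2.le, R_right m (s-h) (by linarith [hh.2])]; simp

lemma quot_bound (m : ℕ) (hm : 0 < m) (s h : ℝ) (h0 : 0 < h) (h1 : h ≤ 1) :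
    |(R m s - R m (s - h)) / h| ≤ (Set.Icc 0 (2 * π + 1)).indicator (fun _ => (1:ℝ)) s := by
  by_cases hs : s ∈ Set.Icc 0 (2 * π + 1)
  · rw [Set.indicator_of_mem hs, abs_div, abs_of_pos h0, div_le_one h0]
    refine (R_lip m hm _ _).trans ?_
    simp [abs_of_pos h0]
  · rw [Set.indicator_of_notMem hs]
    have : s < 0 ∨ 2 * π + 1 < s := by
      by_contra hc; push Not at hc; exact hs ⟨hc.1, hc.2⟩
    rcases this with h | h
    · rw [R_left m s h.le, R_left m (s-_) (by linarith)]; simp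
    · rw [R_right m s (by linarith), R_right m (s-_) (by linarith)]; simp

lemma int_gRR (g : ℝ → ℝ) (hg : Measurable g) (M : ℝ) (hM : ∀ x, |g x| ≤ M) (m n : ℕ)
    (a b c : ℝ) :
    Integrable (fun p : ℝ × ℝ => g (p.1 + p.2 + a) * (R m (p.1 - b) * R n (p.2 - c))) := by
  have hR : ∀ (k : ℕ) (d : ℝ), Integrable (fun x => R k (x - d)) := by
    intro k d
    apply Integrable.comp_sub_right
    refine (R_cont k).integrable_of_hasCompactSupport ?_
    refine HasCompactSupport.intro (isCompact_Icc (a := (0:ℝ)) (b := 2 * π)) ?_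
    intro x hx
    rcases lt_or_ge x 0 with h | h
    · exact R_left k x h.le
    · exact R_right k x (by by_contra hc; exact hx ⟨h, by linarith⟩)
  have h2 := (hR m b).mul_prod (hR n c)
  refine Integrable.bdd_mul (c := M) h2 ?_ ?_
  · exact (hg.comp (by fun_prop)).aestronglyMeasurable
  · exact Eventually.of_forall fun p => by simpa using hM _

lemma J_nonneg (g : ℝ → ℝ) (hg : Measurable g) (M : ℝ) (hM : ∀ x, |g x| ≤ M) (m n : ℕ)
    (hΔ : ∀ u h, 0 ≤ u → 0 < h → 2 * g (u + h) ≤ g u + g (u + 2 * h)) (h : ℝ) (h0 : 0 < h) :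
    0 ≤ ∫ p : ℝ × ℝ, g (p.1 + p.2) * ((R m p.1 - R m (p.1 - h)) / h * ((R n p.2 - R n (p.2 - h)) / h)) := by
  have key : ∀ b c : ℝ, ∫ p : ℝ × ℝ, g (p.1 + p.2) * (R m (p.1 - b) * R n (p.2 - c))
      = ∫ p : ℝ × ℝ, g (p.1 + p.2 + (b + c)) * (R m p.1 * R n p.2) := by
    intro b c
    rw [← integral_add_right_eq_self (μ := (volume : Measure (ℝ × ℝ))) _ ((b, c) : ℝ × ℝ)]
    congr 1; ext p; simp; left; congr 1; ring
  have I := int_gRR g hg M hM m n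
  have I' : ∀ b c, Integrable (fun p : ℝ × ℝ => g (p.1 + p.2) * (R m (p.1 - b) * R n (p.2 - c))) := by
    intro b c; simpa using I 0 b c
  have I'' : ∀ a, Integrable (fun p : ℝ × ℝ => g (p.1 + p.2 + a) * (R m p.1 * R n p.2)) := by
    intro a; simpa using I a 0 0
  have e1 : ∫ p : ℝ × ℝ, g (p.1 + p.2) * ((R m p.1 - R m (p.1 - h)) / h * ((R n p.2 - R n (p.2 - h)) / h))
      = (∫ p : ℝ × ℝ, (g (p.1 + p.2) * (R m (p.1 - 0) * R n (p.2 - 0)) - g (p.1 + p.2) * (R m (p.1 - h) * R n (p.2 - 0)))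
        - (g (p.1 + p.2) * (R m (p.1 - 0) * R n (p.2 - h)) - g (p.1 + p.2) * (R m (p.1 - h) * R n (p.2 - h)))) / h ^ 2 := by
    rw [← MeasureTheory.integral_div]
    congr 1; ext p; simp only [sub_zero]; field_simp
  have e2 : (∫ p : ℝ × ℝ, (g (p.1 + p.2) * (R m (p.1 - 0) * R n (p.2 - 0)) - g (p.1 + p.2) * (R m (p.1 - h) * R n (p.2 - 0)))
        - (g (p.1 + p.2) * (R m (p.1 - 0) * R n (p.2 - h)) - g (p.1 + p.2) * (R m (p.1 - h) * R n (p.2 - h))))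
      = ∫ p : ℝ × ℝ, (g (p.1 + p.2 + (0 + 0)) * (R m p.1 * R n p.2) - g (p.1 + p.2 + (h + 0)) * (R m p.1 * R n p.2))
        - (g (p.1 + p.2 + (0 + h)) * (R m p.1 * R n p.2) - g (p.1 + p.2 + (h + h)) * (R m p.1 * R n p.2)) := by
    have gen : ∀ a b c d : ℝ × ℝ → ℝ, Integrable a → Integrable b → Integrable c → Integrable d →
        ∫ p, (a p - b p) - (c p - d p) = ((∫ p, a p) - ∫ p, b p) - ((∫ p, c p) - ∫ p, d p) := by
      intro a b c d ha hb hc hd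
      rw [← MeasureTheory.integral_sub ha hb, ← MeasureTheory.integral_sub hc hd]
      exact MeasureTheory.integral_sub (ha.sub hb) (hc.sub hd)
    rw [gen _ _ _ _ (I' 0 0) (I' h 0) (I' 0 h) (I' h h), key, key, key, key,
      gen _ _ _ _ (I'' _) (I'' _) (I'' _) (I'' _)]
  rw [e1, e2]
  refine div_nonneg (integral_nonneg fun p => ?_) (by positivity)
  simp only [Pi.zero_apply]
  rcases lt_or_ge p.1 0 with hp | hp
  · simp [R_left m p.1 hp.le]
  rcases lt_or_ge p.2 0 with hq | hq
  · simp [R_left n p.2 hq.le]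
  have := hΔ (p.1 + p.2) h (by linarith) h0
  have hr := mul_nonneg (R_nonneg m p.1) (R_nonneg n p.2)
  rw [two_mul h] at this
  simp only [add_zero, zero_add]
  nlinarith

lemma main (g : ℝ → ℝ) (hg : Measurable g) (M : ℝ) (hM : ∀ x, |g x| ≤ M) (m n : ℕ)
    (hm : 0 < m) (hn : 0 < n)
    (hΔ : ∀ u h, 0 ≤ u → 0 < h → 2 * g (u + h) ≤ g u + g (u + 2 * h)) :
    0 ≤ ∫ s in (0:ℝ)..(2 * π), ∫ t in (0:ℝ)..(2 * π),
      g (s + t) * Real.sin (m * s) * Real.sin (n * t) := by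
  have hpi : (0:ℝ) ≤ 2 * π := by positivity
  have hind : ∀ C : ℝ, Integrable (fun x : ℝ => (Set.Icc 0 (2 * π + 1)).indicator (fun _ => (1:ℝ)) x) := by
    intro _
    rw [integrable_indicator_iff measurableSet_Icc]
    exact integrableOn_const (by simp)
  have hB : Integrable (fun p : ℝ × ℝ => M * ((Set.Icc 0 (2 * π + 1)).indicator (fun _ => (1:ℝ)) p.1 *
      (Set.Icc 0 (2 * π + 1)).indicator (fun _ => (1:ℝ)) p.2)) :=
    ((hind 0).mul_prod (hind 0)).const_mul M
  have hM0 : 0 ≤ M := (abs_nonneg _).trans (hM 0)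
  have hSm : ∀ k, Measurable (S k) := by
    intro k
    unfold S
    exact Measurable.indicator (by fun_prop) measurableSet_Ioc
  have hlim : Tendsto (fun h : ℝ => ∫ p : ℝ × ℝ, g (p.1 + p.2) * ((R m p.1 - R m (p.1 - h)) / h * ((R n p.2 - R n (p.2 - h)) / h)))
      (𝓝[>] 0) (𝓝 (∫ p : ℝ × ℝ, g (p.1 + p.2) * (S m p.1 * S n p.2))) := by
    refine tendsto_integral_filter_of_dominated_convergence _ ?_ ?_ hB ?_
    · refine Eventually.of_forall fun h => ?_
      have := (R_cont m).measurable
      have := (R_cont n).measurable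
      exact Measurable.aestronglyMeasurable (by fun_prop)
    · filter_upwards [Ioc_mem_nhdsGT (zero_lt_one (α := ℝ))] with h hh
      refine Eventually.of_forall fun p => ?_
      rw [Real.norm_eq_abs, abs_mul, abs_mul]
      have a := quot_bound m hm p.1 h hh.1 hh.2
      have b := quot_bound n hn p.2 h hh.1 hh.2
      have := (abs_nonneg _).trans a
      gcongr
      exact hM _
    · refine Eventually.of_forall fun p => ?_
      exact ((quot_tendsto m hm p.1).mul (quot_tendsto n hn p.2)).const_mul _
  have hge : 0 ≤ ∫ p : ℝ × ℝ, g (p.1 + p.2) * (S m p.1 * S n p.2) := by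
    refine ge_of_tendsto hlim ?_
    filter_upwards [self_mem_nhdsWithin] with h hh
    exact J_nonneg g hg M hM m n hΔ h hh
  have hSb : ∀ k x, |S k x| ≤ (Set.Icc 0 (2 * π + 1)).indicator (fun _ => (1:ℝ)) x := by
    intro k x
    unfold S
    by_cases hx : x ∈ Set.Ioc 0 (2 * π)
    · rw [Set.indicator_of_mem hx, Set.indicator_of_mem (show x ∈ Set.Icc 0 (2 * π + 1) from ⟨hx.1.le, by linarith [hx.2]⟩)]
      exact Real.abs_sin_le_one _
    · rw [Set.indicator_of_notMem hx, abs_zero]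
      exact Set.indicator_nonneg (by simp) _
  have hInt : Integrable (fun p : ℝ × ℝ => g (p.1 + p.2) * (S m p.1 * S n p.2)) := by
    refine hB.mono' ?_ ?_
    · have := hSm m
      have := hSm n
      exact Measurable.aestronglyMeasurable (by fun_prop)
    · refine Eventually.of_forall fun p => ?_
      rw [Real.norm_eq_abs, abs_mul, abs_mul]
      have a := hSb m p.1
      have b := hSb n p.2
      have := (abs_nonneg _).trans a
      gcongr
      exact hM _
  rw [Measure.volume_eq_prod] at hge hInt
  rw [integral_prod _ hInt] at hge
  convert hge using 1
  rw [intervalIntegral.integral_of_le hpi, ← MeasureTheory.integral_indicator measurableSet_Ioc]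
  congr 1; ext s
  by_cases hs : s ∈ Set.Ioc 0 (2 * π)
  · rw [Set.indicator_of_mem hs, intervalIntegral.integral_of_le hpi,
      ← MeasureTheory.integral_indicator measurableSet_Ioc]
    congr 1; ext t
    by_cases ht : t ∈ Set.Ioc 0 (2 * π)
    · simp only [S, Set.indicator_of_mem hs, Set.indicator_of_mem ht]; ring
    · simp only [S, Set.indicator_of_notMem ht]; ring
  · simp only [S, Set.indicator_of_notMem hs]; simp

lemma anti (f : ℝ → ℝ)
    (hf : AntitoneOn f (Set.Icc 0 (4 * π)))
    (hc : ConvexOn ℝ (Set.Icc 0 (4 * π)) f)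
    (m n : ℕ) (hm : 0 < m) (hn : 0 < n) :
    0 ≤ ∫ s in (0:ℝ)..(2 * π), ∫ t in (0:ℝ)..(2 * π),
      f (s + t) * Real.sin (m * s) * Real.sin (n * t) := by
  have hpi : (0:ℝ) < π := Real.pi_pos
  set g : ℝ → ℝ := fun x => f (max 0 (min x (4 * π))) with hgdef
  have hmem : ∀ x : ℝ, max 0 (min x (4 * π)) ∈ Set.Icc 0 (4 * π) := fun x =>
    ⟨le_max_left _ _, max_le (by positivity) (min_le_right _ _)⟩
  have hga : Antitone g := fun x y hxy => hf (hmem x) (hmem y) (by gcongr)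
  have hgf : ∀ x ∈ Set.Icc 0 (4 * π), g x = f x := by
    intro x hx
    simp only [hgdef]; rw [min_eq_left hx.2, max_eq_right hx.1]
  have hgr : ∀ x, 4 * π ≤ x → g x = f (4 * π) := by
    intro x hx
    simp only [hgdef]; rw [min_eq_right hx, max_eq_right (by positivity)]
  have h0m : (0:ℝ) ∈ Set.Icc 0 (4 * π) := ⟨le_rfl, by positivity⟩
  have h4m : (4 * π) ∈ Set.Icc 0 (4 * π) := ⟨by positivity, le_rfl⟩
  have hmid : ∀ a b, a ∈ Set.Icc 0 (4 * π) → b ∈ Set.Icc 0 (4 * π) → 2 * f ((a + b) / 2) ≤ f a + f b := by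
    intro a b ha hb
    have := hc.2 ha hb (by norm_num : (0:ℝ) ≤ 1/2) (by norm_num : (0:ℝ) ≤ 1/2) (by norm_num)
    simp only [smul_eq_mul] at this
    rw [show 1 / 2 * a + 1 / 2 * b = (a + b) / 2 by ring] at this
    linarith
  have hmain := main g hga.measurable (max |f 0| |f (4 * π)|) ?_ m n hm hn ?_
  · convert hmain using 1
    apply intervalIntegral.integral_congr
    intro s hs
    apply intervalIntegral.integral_congr
    intro t ht
    rw [Set.uIcc_of_le (by positivity)] at hs ht
    simp only
    rw [hgf (s + t) ⟨by linarith [hs.1, ht.1], by linarith [hs.2, ht.2]⟩]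
  · intro x
    have a : g x ≤ f 0 := hf h0m (hmem x) (hmem x).1
    have b : f (4 * π) ≤ g x := hf (hmem x) h4m (hmem x).2
    rw [max_comm]
    exact abs_le_max_abs_abs b a
  · intro u h hu hh
    rcases le_or_gt (u + 2 * h) (4 * π) with h1 | h1
    · have := hmid u (u + 2 * h) ⟨hu, by linarith⟩ ⟨by linarith, h1⟩
      rw [hgf u ⟨hu, by linarith⟩, hgf (u + 2 * h) ⟨by linarith, h1⟩,
        hgf (u + h) ⟨by linarith, by linarith⟩]
      rwa [show (u + (u + 2 * h)) / 2 = u + h by ring] at this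
    rcases le_or_gt (u + h) (4 * π) with h2 | h2
    · have hv : 2 * (u + h) - 4 * π ∈ Set.Icc 0 (4 * π) := ⟨by linarith, by linarith⟩
      rw [hgr (u + 2 * h) h1.le]
      have := hmid _ _ hv h4m
      rw [show (2 * (u + h) - 4 * π + 4 * π) / 2 = u + h by ring] at this
      rw [hgf (u + h) ⟨by linarith, h2⟩]
      have h5 : g (2 * (u + h) - 4 * π) ≤ g u := hga (by linarith)
      rw [hgf _ hv] at h5
      linarith
    · rw [hgr (u + h) h2.le, hgr (u + 2 * h) h1.le]
      have : f (4 * π) ≤ g u := hf (hmem u) h4m (hmem u).2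
      linarith

end SineAux

/-- Proposition 1 of the paper: for every monotone and convex function
`f : [0, 4π] → ℝ` and all positive integers `m`, `n`,
`∫_0^{2π} ∫_0^{2π} f(s+t) sin(ms) sin(nt) ds dt ≥ 0`. -/
theorem sine_fourier_double_integral_nonneg
    (f : ℝ → ℝ)
    (hf_mono : MonotoneOn f (Set.Icc 0 (4 * π)) ∨ AntitoneOn f (Set.Icc 0 (4 * π)))
    (hf_conv : ConvexOn ℝ (Set.Icc 0 (4 * π)) f)
    (m n : ℕ) (hm : 0 < m) (hn : 0 < n) :
    0 ≤ ∫ s in (0:ℝ)..(2 * π), ∫ t in (0:ℝ)..(2 * π),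
      f (s + t) * Real.sin (m * s) * Real.sin (n * t) := by
  rcases hf_mono with hf | hf
  swap
  · exact SineAux.anti f hf hf_conv m n hm hn
  have hpi := Real.pi_pos
  have hmap : ∀ x ∈ Set.Icc 0 (4 * π), 4 * π - x ∈ Set.Icc 0 (4 * π) := fun x hx =>
    ⟨by linarith [hx.2], by linarith [hx.1]⟩
  have h := SineAux.anti (fun x => f (4 * π - x))
    (fun x hx y hy hxy => hf (hmap y hy) (hmap x hx) (by linarith))
    ⟨hf_conv.1, fun x hx y hy a b ha hb hab => by
      have := hf_conv.2 (hmap x hx) (hmap y hy) ha hb hab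
      simp only [smul_eq_mul] at this ⊢
      convert this using 2
      linear_combination (-4 * π) * hab⟩ m n hm hn
  have hsin : ∀ (k : ℕ) (x : ℝ), Real.sin (k * (2 * π - x)) = - Real.sin (k * x) := by
    intro k x
    rw [mul_sub, Real.sin_nat_mul_two_pi_sub]
  convert h using 1
  have e := intervalIntegral.integral_comp_sub_left (a := 0) (b := 2 * π) (fun s => ∫ t in (0:ℝ)..(2 * π),
      f (s + t) * Real.sin (m * s) * Real.sin (n * t)) (2 * π)
  rw [sub_self, sub_zero] at e
  rw [← e]
  congr 1; ext s
  have e2 := intervalIntegral.integral_comp_sub_left (a := 0) (b := 2 * π) (fun t =>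
      f (2 * π - s + t) * Real.sin (m * (2 * π - s)) * Real.sin (n * t)) (2 * π)
  rw [sub_self, sub_zero] at e2
  rw [← e2]
  congr 1; ext t
  rw [hsin, hsin, show 2 * π - s + (2 * π - t) = 4 * π - (s + t) by ring]
  ring
end

section
/- The function C(x,y) = (eˣ + eʸ − 1)⁻¹ is 2d-monotone on [0,∞) × [0,∞), i.e., for all 0 ≤ a ≤ b and 0 ≤ c ≤ d one has (e^a + e^c − 1)⁻¹ − (e^a + e^d − 1)⁻¹ − (e^b + e^c − 1)⁻¹ + (e^b + e^d − 1)⁻¹ ≥ 0. -/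
open Real

/-- The function `C(x,y) = (eˣ + eʸ - 1)⁻¹` is 2d-monotone on `[0,∞) × [0,∞)`. -/
theorem inv_exp_add_exp_sub_one_twoD_monotone
    (a b c d : ℝ) (ha : 0 ≤ a) (hc : 0 ≤ c) (hab : a ≤ b) (hcd : c ≤ d) :
    0 ≤ (Real.exp a + Real.exp c - 1)⁻¹ - (Real.exp a + Real.exp d - 1)⁻¹
      - (Real.exp b + Real.exp c - 1)⁻¹ + (Real.exp b + Real.exp d - 1)⁻¹ := by
  have hA : 1 ≤ Real.exp a := Real.one_le_exp ha
  have hC : 1 ≤ Real.exp c := Real.one_le_exp hc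
  have key : ∀ s p q : ℝ, 0 < s → 0 ≤ p → 0 ≤ q →
      0 ≤ s⁻¹ - (s + q)⁻¹ - (s + p)⁻¹ + (s + p + q)⁻¹ := by
    intro s p q hs hp hq
    have h1 : 0 < s + q := by linarith
    have h2 : 0 < s + p := by linarith
    have h3 : 0 < s + p + q := by linarith
    have e : s⁻¹ - (s + q)⁻¹ - (s + p)⁻¹ + (s + p + q)⁻¹
        = p * q * (2 * s + p + q) / (s * (s + q) * (s + p) * (s + p + q)) := by
      field_simp
      ring
    rw [e]
    positivity
  have h := key (Real.exp a + Real.exp c - 1) (Real.exp b - Real.exp a)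
    (Real.exp d - Real.exp c) (by linarith)
    (sub_nonneg.2 (Real.exp_le_exp.2 hab)) (sub_nonneg.2 (Real.exp_le_exp.2 hcd))
  convert h using 3 <;> ring
end
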